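/- arXiv:2506.07752 — 8 statements merged into one kernel-verified Lean document; each statement's English description precedes it below -/
import Mathlib

section
/- Let γ ⊆ ℝ^d and let f : γ → ℝ^D be a bi-Lipschitz embedding, i.e. there are constants 0 < c ≤ C such that c|x-y| ≤ |f(x)-f(y)| ≤ C|x-y| for all x,y ∈ γ. If μ ∈ M(γ), then the pushforward measure f_*μ belongs to M(f(γ)); that is, for every x̄ ∈ f(γ) the function ȳ ↦ -log|x̄-ȳ| is (f_*μ)-integrable, and the potential x̄ ↦ ∫ -log|x̄-ȳ| d(f_*μ)(ȳ) is continuous as a function on the support of f_*μ. -/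
open MeasureTheory

/-- The support of a measure on a metric space: the set of points all of whose
neighbourhoods have positive measure. -/
def measSupport {E : Type*} [PseudoMetricSpace E] [MeasurableSpace E]
    (μ : Measure E) : Set E :=
  {x | ∀ r : ℝ, 0 < r → 0 < μ (Metric.ball x r)}

/-- The class `M(γ)` of Radon measures with compact support contained in `γ` such that
the logarithmic kernel is integrable at every point of `γ` and the logarithmic potential
is continuous on the support of the measure. -/
def MemLogPotClass {E : Type*} [PseudoMetricSpace E] [MeasurableSpace E]
    (γ : Set E) (μ : Measure E) : Prop :=
  IsFiniteMeasure μ ∧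
  (∃ K : Set E, IsCompact K ∧ K ⊆ γ ∧ μ Kᶜ = 0) ∧
  (∀ x ∈ γ, Integrable (fun y => -Real.log (dist x y)) μ) ∧
  ContinuousOn (fun x => ∫ y, -Real.log (dist x y) ∂μ) (measSupport μ)

/-- Bounded difference of the two logarithmic kernels. -/
lemma log_kernel_diff_bound {a b c C : ℝ} (hc : 0 < c) (ha : 0 ≤ a)
    (h1 : c * a ≤ b) (h2 : b ≤ C * a) :
    |-Real.log b - -Real.log a| ≤ |Real.log c| + |Real.log C| := by
  rcases ha.eq_or_lt with h | h
  · subst h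
    have : b = 0 := by linarith
    subst this
    simp only [sub_self, abs_zero]
    positivity
  · have hb : 0 < b := lt_of_lt_of_le (by positivity) h1
    have hC : 0 < C := by
      by_contra hC
      push Not at hC
      nlinarith
    have e1 := Real.log_le_log (by positivity) h1
    have e2 := Real.log_le_log hb h2
    rw [Real.log_mul hc.ne' h.ne'] at e1
    rw [Real.log_mul hC.ne' h.ne'] at e2
    rw [abs_le]
    have := neg_abs_le (Real.log c)
    have := le_abs_self (Real.log C)
    have := abs_nonneg (Real.log C)
    have := abs_nonneg (Real.log c)
    constructor <;> linarith

/-- An atom is isolated in the set where the (punctured) potential is continuous. -/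
lemma atom_isolated {E : Type*} [MetricSpace E] [MeasurableSpace E] [BorelSpace E]
    (μ : Measure E) [IsFiniteMeasure μ] (K S : Set E) (hK : IsCompact K)
    (hKn : ∀ᵐ y ∂μ, y ∈ K)
    (hint : ∀ x ∈ K, Integrable (fun y => -Real.log (dist x y)) μ)
    (hS : S ⊆ K)
    (hcont : ContinuousOn (fun x => ∫ y, -Real.log (dist x y) ∂μ) S)
    (p : E) (hp : p ∈ S) (hatom : μ {p} ≠ 0) : nhdsWithin p (S \ {p}) = ⊥ := by
  by_contra hne
  have : (nhdsWithin p (S \ {p})).NeBot := ⟨hne⟩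
  have h1 : Filter.Tendsto (fun x => ∫ y, -Real.log (dist x y) ∂μ) (nhdsWithin p (S \ {p}))
      (nhds (∫ y, -Real.log (dist p y) ∂μ)) :=
    (hcont p hp).mono_left (nhdsWithin_mono _ Set.sdiff_subset)
  refine not_tendsto_nhds_of_tendsto_atTop ?_ _ h1
  set L := Real.log (max 1 (Metric.diam K)) with hL
  have hL0 : 0 ≤ L := Real.log_nonneg (le_max_left _ _)
  have hm : 0 < μ.real {p} := by
    rw [Measure.real, ENNReal.toReal_pos_iff]
    exact ⟨pos_iff_ne_zero.2 hatom, measure_lt_top _ _⟩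
  have hlow : ∀ x ∈ S, μ.real {p} * (-Real.log (dist x p) + L) - L * μ.real Set.univ
      ≤ ∫ y, -Real.log (dist x y) ∂μ := by
    intro x hx
    have hi : Integrable (fun y => -Real.log (dist x y) + L) μ :=
      (hint x (hS hx)).add (integrable_const _)
    have hnn : 0 ≤ᵐ[μ] fun y => -Real.log (dist x y) + L := by
      filter_upwards [hKn] with y hy
      have hd : dist x y ≤ max 1 (Metric.diam K) :=
        (Metric.dist_le_diam_of_mem hK.isBounded (hS hx) hy).trans (le_max_right _ _)
      have : Real.log (dist x y) ≤ L := by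
        rcases (dist_nonneg (x := x) (y := y)).eq_or_lt with h | h
        · rw [← h, Real.log_zero]; exact hL0
        · exact Real.log_le_log h hd
      simp only [Pi.zero_apply]
      linarith
    have h2 := setIntegral_le_integral (s := {p}) hi hnn
    rw [integral_singleton, integral_add (hint x (hS hx)) (integrable_const _),
      integral_const, smul_eq_mul, smul_eq_mul] at h2
    linarith
  have hd : Filter.Tendsto (fun x => dist x p) (nhdsWithin p (S \ {p}))
      (nhdsWithin 0 (Set.Ioi 0)) := by
    rw [tendsto_nhdsWithin_iff]
    constructor
    · have : Filter.Tendsto (fun x => dist x p) (nhds p) (nhds (dist p p)) :=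
        (continuous_id.dist continuous_const).tendsto p
      rw [dist_self] at this
      exact this.mono_left nhdsWithin_le_nhds
    · filter_upwards [self_mem_nhdsWithin] with x hx
      exact dist_pos.2 hx.2
  have hlog := Filter.tendsto_neg_atBot_atTop.comp (Real.tendsto_log_nhdsGT_zero.comp hd)
  have hfull := Filter.tendsto_atTop_add_const_right _ (-(L * μ.real Set.univ))
    ((Filter.tendsto_atTop_add_const_right _ L hlog).const_mul_atTop hm)
  refine Filter.tendsto_atTop_mono' _ ?_ hfull
  filter_upwards [self_mem_nhdsWithin] with x hx
  have := hlow x hx.1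
  simp only [Function.comp]
  linarith

lemma biLip_core {E F : Type*} [MetricSpace E] [MeasurableSpace E] [BorelSpace E]
    [MetricSpace F] [MeasurableSpace F] [BorelSpace F] [SecondCountableTopology E]
    [SecondCountableTopology F]
    (γ : Set E) (f : E → F) (c C : ℝ) (hc : 0 < c) (hcC : c ≤ C)
    (hbil : ∀ x ∈ γ, ∀ y ∈ γ,
      c * dist x y ≤ dist (f x) (f y) ∧ dist (f x) (f y) ≤ C * dist x y)
    (μ : Measure E) (hμ : MemLogPotClass γ μ) :
    (∀ xb ∈ f '' γ, Integrable (fun yb => -Real.log (dist xb yb)) (μ.map f)) ∧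
    ContinuousOn (fun xb => ∫ yb, -Real.log (dist xb yb) ∂(μ.map f))
      (measSupport (μ.map f)) := by
  obtain ⟨hfin, ⟨K, hK, hKγ, hK0⟩, hint, hcont⟩ := hμ
  have hCpos : 0 < C := hc.trans_le hcC
  have hKae : ∀ᵐ y ∂μ, y ∈ K := hK0
  have hflip : LipschitzOnWith C.toNNReal f γ := by
    refine LipschitzOnWith.of_dist_le_mul fun x hx y hy => ?_
    rw [Real.coe_toNNReal _ hCpos.le]
    exact (hbil x hx y hy).2
  have hfK : ContinuousOn f K := hflip.continuousOn.mono hKγ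
  have hfm : AEMeasurable f μ := by
    have := hfK.aemeasurable (μ := μ) hK.measurableSet
    rwa [Measure.restrict_eq_self_of_ae_mem hKae] at this
  have hkm : ∀ z : F, Measurable (fun w : F => -Real.log (dist z w)) := fun z =>
    (Real.measurable_log.comp (measurable_const.dist measurable_id)).neg
  have hkm' : ∀ z : E, Measurable (fun w : E => -Real.log (dist z w)) := fun z =>
    (Real.measurable_log.comp (measurable_const.dist measurable_id)).neg
  have hkf : ∀ z : F, AEStronglyMeasurable (fun y => -Real.log (dist z (f y))) μ := fun z =>
    ((hkm z).comp_aemeasurable hfm).aestronglyMeasurable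
  set M := |Real.log c| + |Real.log C| with hM
  have hbd : ∀ x ∈ γ, ∀ᵐ y ∂μ,
      ‖-Real.log (dist (f x) (f y)) - -Real.log (dist x y)‖ ≤ M := by
    intro x hx
    filter_upwards [hKae] with y hy
    exact log_kernel_diff_bound hc dist_nonneg (hbil x hx y (hKγ hy)).1 (hbil x hx y (hKγ hy)).2
  have hdint : ∀ x ∈ γ, Integrable
      (fun y => -Real.log (dist (f x) (f y)) - -Real.log (dist x y)) μ := by
    intro x hx
    exact Integrable.of_bound ((hkf (f x)).sub (hkm' x).aestronglyMeasurable) M (hbd x hx)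
  have hfint : ∀ x ∈ γ, Integrable (fun y => -Real.log (dist (f x) (f y))) μ := by
    intro x hx
    have := (hdint x hx).add (hint x hx)
    refine this.congr (Filter.Eventually.of_forall fun y => ?_)
    simp
  constructor
  · rintro _ ⟨x, hx, rfl⟩
    rw [integrable_map_measure (hkm _).aestronglyMeasurable hfm]
    exact hfint x hx
  have hH : ContinuousOn (fun x => ∫ y, -Real.log (dist (f x) (f y)) ∂μ)
      (measSupport μ ∩ K) := by
    intro p hp
    by_cases hat : μ {p} = 0
    · have hD : ContinuousWithinAt
          (fun x => ∫ y, (-Real.log (dist (f x) (f y)) - -Real.log (dist x y)) ∂μ)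
          (measSupport μ ∩ K) p := by
        apply continuousWithinAt_of_dominated (bound := fun _ => M)
        · filter_upwards [self_mem_nhdsWithin] with x hx
          exact (hdint x (hKγ hx.2)).aestronglyMeasurable
        · filter_upwards [self_mem_nhdsWithin] with x hx
          exact hbd x (hKγ hx.2)
        · exact integrable_const _
        · have hpne : ∀ᵐ y ∂μ, y ≠ p := by
            rw [ae_iff]; simpa using hat
          filter_upwards [hKae, hpne] with y hy hyp
          have hpy : dist p y ≠ 0 := dist_ne_zero.2 hyp.symm
          have hfpy : dist (f p) (f y) ≠ 0 := by
            have := (hbil p (hKγ hp.2) y (hKγ hy)).1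
            have h2 : 0 < dist p y := dist_pos.2 hyp.symm
            have : 0 < dist (f p) (f y) := lt_of_lt_of_le (by positivity) this
            exact this.ne'
          have hfp : ContinuousWithinAt f (measSupport μ ∩ K) p :=
            (hfK p hp.2).mono Set.inter_subset_right
          have hid : ContinuousWithinAt (fun x : E => x) (measSupport μ ∩ K) p :=
            continuousWithinAt_id
          exact ((hfp.dist continuousWithinAt_const).log hfpy).neg.sub
            ((hid.dist continuousWithinAt_const).log hpy).neg
      have hG := (hcont p hp.1).mono (Set.inter_subset_left (t := K))
      refine (hD.add hG).congr_of_mem (fun x hx => ?_) hp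
      have := integral_sub (hfint x (hKγ hx.2)) (hint x (hKγ hx.2))
      simp only [Pi.add_apply]
      rw [this]; ring
    · have hbot := atom_isolated μ K (measSupport μ ∩ K) hK hKae
        (fun x hx => hint x (hKγ hx)) Set.inter_subset_right
        (hcont.mono Set.inter_subset_left) p hp hat
      rw [← continuousWithinAt_sdiff_self, ContinuousWithinAt, hbot]
      exact Filter.tendsto_bot
  have hsupp : ∀ z ∈ measSupport (μ.map f), ∃ x ∈ measSupport μ ∩ K, f x = z := by
    intro z hz
    have hzK : z ∈ f '' K := by
      by_contra hzn
      have hcl : IsClosed (f '' K) := (hK.image_of_continuousOn hfK).isClosed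
      obtain ⟨r, hr, hrs⟩ := Metric.isOpen_iff.1 hcl.isOpen_compl z hzn
      have h0 := hz r hr
      rw [Measure.map_apply_of_aemeasurable hfm Metric.isOpen_ball.measurableSet] at h0
      refine h0.ne' (measure_mono_null ?_ hK0)
      intro y hy hyK
      exact hrs hy ⟨y, hyK, rfl⟩
    obtain ⟨x, hx, rfl⟩ := hzK
    refine ⟨x, ⟨fun r hr => ?_, hx⟩, rfl⟩
    have h0 := hz (c * r) (by positivity)
    rw [Measure.map_apply_of_aemeasurable hfm Metric.isOpen_ball.measurableSet] at h0
    refine h0.trans_le (measure_mono_ae ?_)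
    filter_upwards [hKae] with y hy hy2
    have h3 : dist (f y) (f x) < c * r := hy2
    have h4 := (hbil y (hKγ hy) x (hKγ hx)).1
    exact lt_of_mul_lt_mul_left (h4.trans_lt h3) hc.le
  rcases (measSupport (μ.map f)).eq_empty_or_nonempty with hemp | ⟨z₀, hz₀⟩
  · rw [hemp]
    exact continuousOn_empty _
  have hne : Nonempty E := ⟨(hsupp z₀ hz₀).choose⟩
  choose! g hg hfg using hsupp
  have hgl : ContinuousOn g (measSupport (μ.map f)) := by
    refine (LipschitzOnWith.of_dist_le_mul (K := (c⁻¹).toNNReal) fun z hz w hw => ?_).continuousOn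
    rw [Real.coe_toNNReal _ (by positivity)]
    have := (hbil (g z) (hKγ (hg z hz).2) (g w) (hKγ (hg w hw).2)).1
    rw [hfg z hz, hfg w hw] at this
    rw [inv_mul_eq_div, le_div_iff₀ hc]
    linarith
  refine (hH.comp hgl hg).congr fun z hz => ?_
  simp only [Function.comp]
  rw [integral_map hfm (hkm _).aestronglyMeasurable, hfg z hz]

/-- **Bi-Lipschitz pushforwards of measures with continuous logarithmic potential.**
If `f` is bi-Lipschitz on `γ` and `μ ∈ M(γ)`, then `f_*μ ∈ M(f(γ))`. -/
theorem biLipschitz_pushforward_logPot (d D : ℕ) (γ : Set (EuclideanSpace ℝ (Fin d)))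
    (f : EuclideanSpace ℝ (Fin d) → EuclideanSpace ℝ (Fin D))
    (c C : ℝ) (hc : 0 < c) (hcC : c ≤ C)
    (hbil : ∀ x ∈ γ, ∀ y ∈ γ,
      c * dist x y ≤ dist (f x) (f y) ∧ dist (f x) (f y) ≤ C * dist x y)
    (μ : Measure (EuclideanSpace ℝ (Fin d))) (hμ : MemLogPotClass γ μ) :
    (∀ xb ∈ f '' γ, Integrable (fun yb => -Real.log (dist xb yb)) (μ.map f)) ∧
    ContinuousOn (fun xb => ∫ yb, -Real.log (dist xb yb) ∂(μ.map f))
      (measSupport (μ.map f)) := by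
  exact biLip_core γ f c C hc hcC hbil μ hμ
end

section
/- Let μ be a finite Radon measure on ℝ, let α ∈ (0,1) and p ∈ [1,∞]. Then there is a constant C depending only on α such that μ(B(x,r)) ≤ C · ‖K_αμ‖_{L^p(ℝ)} · r^{α - 1/p} for every x ∈ ℝ and every r ∈ (0,1], where K_αμ(x) = ∫ |x-y|^{-α} dμ(y) is the α-dimensional Riesz potential of μ (and 1/p is interpreted as 0 when p = ∞). -/
open MeasureTheory
open scoped ENNReal

/-- The `α`-dimensional Riesz potential `K_α μ(x) = ∫ |x-y|^{-α} dμ(y)`, with values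
in `[0,∞]`. -/
noncomputable def rieszPotential (α : ℝ) (μ : Measure ℝ) (x : ℝ) : ℝ≥0∞ :=
  ∫⁻ y, (edist x y) ^ (-α) ∂μ

/-- The `L^p` norm (with respect to Lebesgue measure) of a `[0,∞]`-valued function on `ℝ`,
for `p ∈ [1,∞]`. -/
noncomputable def lpNormENN (f : ℝ → ℝ≥0∞) (p : ℝ≥0∞) : ℝ≥0∞ :=
  if p = ∞ then essSup f volume else (∫⁻ x, f x ^ p.toReal) ^ (1 / p.toReal)

lemma riesz_lower (α : ℝ) (hα0 : 0 < α) (μ : Measure ℝ) (x r : ℝ) (z : ℝ)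
    (hz : z ∈ Metric.ball x r) :
    μ (Metric.ball x r) * (ENNReal.ofReal (2 * r)) ^ (-α) ≤ rieszPotential α μ z := by
  unfold rieszPotential
  calc μ (Metric.ball x r) * (ENNReal.ofReal (2 * r)) ^ (-α)
      = ∫⁻ _ in Metric.ball x r, (ENNReal.ofReal (2 * r)) ^ (-α) ∂μ := by
        rw [setLIntegral_const, mul_comm]
    _ ≤ ∫⁻ y in Metric.ball x r, (edist z y) ^ (-α) ∂μ := by
        refine setLIntegral_mono' measurableSet_ball ?_
        intro y hy
        rw [ENNReal.rpow_neg, ENNReal.rpow_neg, ENNReal.inv_le_inv]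
        refine ENNReal.rpow_le_rpow ?_ hα0.le
        rw [edist_dist]
        refine ENNReal.ofReal_le_ofReal ?_
        have h1 := dist_triangle_right z y x
        rw [Metric.mem_ball] at hz hy
        linarith
    _ ≤ _ := setLIntegral_le_lintegral _ _

lemma lp_lower (f : ℝ → ℝ≥0∞) (p : ℝ≥0∞) (hp : 1 ≤ p) (x r : ℝ) (hr : 0 < r) (c : ℝ≥0∞)
    (hc : ∀ z ∈ Metric.ball x r, c ≤ f z) :
    c * (ENNReal.ofReal (2 * r)) ^ ((1 / p).toReal) ≤ lpNormENN f p := by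
  unfold lpNormENN
  split_ifs with h
  · subst h
    simp only [one_div, ENNReal.inv_top, ENNReal.toReal_zero, ENNReal.rpow_zero, mul_one]
    by_contra hlt
    rw [not_le] at hlt
    have h1 := ae_lt_of_essSup_lt hlt
    have h2 : volume (Metric.ball x r) = 0 := by
      refine measure_mono_null ?_ (ae_iff.mp h1)
      intro z hz
      exact not_lt.mpr (hc z hz)
    rw [Real.volume_ball, ENNReal.ofReal_eq_zero] at h2
    linarith
  · have hP : 0 < p.toReal := ENNReal.toReal_pos (by rintro rfl; simp at hp) h
    have h1 : c ^ p.toReal * ENNReal.ofReal (2 * r) ≤ ∫⁻ z, f z ^ p.toReal := by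
      calc c ^ p.toReal * ENNReal.ofReal (2 * r)
          = ∫⁻ _ in Metric.ball x r, c ^ p.toReal := by
            rw [setLIntegral_const, Real.volume_ball]
        _ ≤ ∫⁻ z in Metric.ball x r, f z ^ p.toReal :=
            setLIntegral_mono' measurableSet_ball
              fun z hz => ENNReal.rpow_le_rpow (hc z hz) hP.le
        _ ≤ _ := setLIntegral_le_lintegral _ _
    have h2 := ENNReal.rpow_le_rpow h1 (one_div_pos.mpr hP).le
    rw [ENNReal.mul_rpow_of_nonneg _ _ (one_div_pos.mpr hP).le, ← ENNReal.rpow_mul,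
      mul_one_div_cancel hP.ne', ENNReal.rpow_one] at h2
    have h3 : (1 / p).toReal = 1 / p.toReal := by simp
    rw [h3]
    exact h2

/-- **Frostman estimates from `L^p` bounds on Riesz potentials.** For a finite measure `μ`
on `ℝ`, `α ∈ (0,1)` and `p ∈ [1,∞]`,
`μ(B(x,r)) ≤ C(α) ‖K_α μ‖_{L^p} r^{α - 1/p}` for `0 < r ≤ 1`. -/
theorem frostman_from_riesz (α : ℝ) (hα0 : 0 < α) (hα1 : α < 1) :
    ∃ C : ℝ, 0 < C ∧
      ∀ (μ : Measure ℝ), IsFiniteMeasure μ →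
        ∀ (p : ℝ≥0∞), 1 ≤ p →
          ∀ (x r : ℝ), 0 < r → r ≤ 1 →
            μ (Metric.ball x r) ≤
              ENNReal.ofReal C * lpNormENN (rieszPotential α μ) p *
                ENNReal.ofReal (r ^ (α - (1 / p).toReal)) := by
  refine ⟨2, by norm_num, ?_⟩
  intro μ _ p hp x r hr _
  have key := lp_lower (rieszPotential α μ) p hp x r hr _
    (fun z hz => riesz_lower α hα0 μ x r z hz)
  have hq : 0 ≤ (1 / p).toReal := ENNReal.toReal_nonneg
  generalize (1 / p).toReal = q at *
  generalize lpNormENN (rieszPotential α μ) p = N at *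
  have h2r : 0 < 2 * r := by linarith
  have hV0 : ENNReal.ofReal (2 * r) ≠ 0 := by simpa using hr
  have hVt : ENNReal.ofReal (2 * r) ≠ ∞ := ENNReal.ofReal_ne_top
  have e1 : (ENNReal.ofReal (2 * r)) ^ (-α) * (ENNReal.ofReal (2 * r)) ^ q *
      (ENNReal.ofReal (2 * r)) ^ (α - q) = 1 := by
    rw [← ENNReal.rpow_add _ _ hV0 hVt, ← ENNReal.rpow_add _ _ hV0 hVt]
    have : -α + q + (α - q) = 0 := by ring
    rw [this, ENNReal.rpow_zero]
  have e2 : (ENNReal.ofReal (2 * r)) ^ (α - q) ≤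
      ENNReal.ofReal 2 * ENNReal.ofReal (r ^ (α - q)) := by
    rw [ENNReal.ofReal_rpow_of_pos h2r, ← ENNReal.ofReal_mul (by norm_num),
      Real.mul_rpow (by norm_num) hr.le]
    refine ENNReal.ofReal_le_ofReal ?_
    refine mul_le_mul_of_nonneg_right ?_ (Real.rpow_nonneg hr.le _)
    calc (2 : ℝ) ^ (α - q) ≤ 2 ^ (1 : ℝ) :=
          Real.rpow_le_rpow_of_exponent_le (by norm_num) (by linarith)
      _ = 2 := Real.rpow_one 2
  calc μ (Metric.ball x r)
      = μ (Metric.ball x r) * (ENNReal.ofReal (2 * r)) ^ (-α) * (ENNReal.ofReal (2 * r)) ^ q *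
          (ENNReal.ofReal (2 * r)) ^ (α - q) := by
        rw [mul_assoc (μ _), mul_assoc (μ _), e1, mul_one]
    _ ≤ N * (ENNReal.ofReal 2 * ENNReal.ofReal (r ^ (α - q))) := mul_le_mul' key e2
    _ = _ := by ring
end

section
/- There exists an absolute constant C₀ ≥ 1 with the following property. For every ε ∈ (0,1] and R ∈ [1,∞) there exist a function log_{ε,R} : ℝ → ℝ and a constant C_R ∈ ℝ depending only on R, with |C_R| ≤ C₀(1 + log R), such that: log_{ε,R} is four times continuously differentiable on ℝ∖{0} and Lipschitz on ℝ; log_{ε,R} vanishes outside [-2R, 2R]; log_{ε,R}(x) = -log|x| + C_R for ε ≤ |x| ≤ R; |log_{ε,R}(x)| ≤ C₀(1+log R) for |x| > R; |log_{ε,R}(x) - C_R| ≤ C₀(1 + log(1/ε)) for |x| ≤ ε; and the derivative k_{ε,R} = (log_{ε,R})' is an odd function on ℝ∖{0}, three times continuously differentiable on ℝ∖{0}, vanishing outside [-2R,2R], with |k_{ε,R}(x)| ≤ C₀/ε for all x ≠ 0 and |k_{ε,R}^{(j)}(x)| ≤ C₀ |x|^{-1-j} for all x ≠ 0 and j ∈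 {0,1,2,3}. Moreover the family can be chosen so that the restriction of log_{ε,R} to ℝ∖[-R,R] does not depend on ε, and the restriction of log_{ε,R} - C_R to [-ε,ε] does not depend on R. -/
open Filter Topology

theorem aux_iter_scale (f : ℝ → ℝ) (c : ℝ) (n : ℕ) :
    iteratedDeriv n (fun x => f (c * x)) = fun x => c ^ n * iteratedDeriv n f (c * x) := by
  induction n with
  | zero => simp
  | succ n ih =>
    rw [iteratedDeriv_succ, ih]
    funext x
    rw [deriv_const_mul_field, deriv_comp_mul_left c (iteratedDeriv n f) x, iteratedDeriv_succ,
      smul_eq_mul, pow_succ]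
    ring

theorem aux_iter_log (n : ℕ) (y : ℝ) (hy : y ≠ 0) :
    y ^ (n + 1) * iteratedDeriv (n + 1) Real.log y = iteratedDeriv (n + 1) Real.log 1 := by
  have h := congrFun (aux_iter_scale Real.log y (n + 1)) 1
  simp only [mul_one] at h
  rw [← h, iteratedDeriv_succ', iteratedDeriv_succ']
  congr 1
  funext x
  rw [deriv_comp_mul_left y Real.log x, Real.deriv_log, Real.deriv_log, smul_eq_mul, mul_inv,
    ← mul_assoc, mul_inv_cancel₀ hy, one_mul]

/-- The model outer truncation of `-log|x|`. -/
theorem aux_G : ∃ G : ℝ → ℝ, (∀ x, x ≠ 0 → ContDiffAt ℝ 4 G x) ∧ (∀ x, G (-x) = G x) ∧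
    (∀ x, |x| ≤ 1 → G x = -Real.log x) ∧ (∀ x, 2 ≤ |x| → G x = 0) ∧
    (∀ x, 1 ≤ |x| → |G x| ≤ Real.log 2) := by
  let χ : ContDiffBump (0 : ℝ) := ⟨1, 2, by norm_num, by norm_num⟩
  have h0 : ∀ x : ℝ, 2 ≤ |x| → χ x = 0 := fun x hx => χ.zero_of_le_dist (by
    simpa [χ] using hx)
  refine ⟨fun x => -(χ x * Real.log x), ?_, ?_, ?_, ?_, ?_⟩
  · intro x hx
    exact (χ.contDiffAt.mul (Real.contDiffAt_log.2 hx)).neg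
  · intro x
    simp [χ.neg]
  · intro x hx
    have : χ x = 1 := χ.one_of_mem_closedBall (by simpa [χ] using hx)
    simp [this]
  · intro x hx
    simp [h0 x hx]
  · intro x hx
    have hl2 : 0 < Real.log 2 := Real.log_pos (by norm_num)
    rcases le_total 2 |x| with h | h
    · simp [h0 x h, hl2.le]
    · rw [abs_neg, abs_mul, abs_of_nonneg χ.nonneg, ← Real.log_abs x,
        abs_of_nonneg (Real.log_nonneg hx)]
      calc χ x * Real.log |x| ≤ 1 * Real.log |x| :=
            mul_le_mul_of_nonneg_right χ.le_one (Real.log_nonneg hx)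
        _ ≤ Real.log 2 := by rw [one_mul]; exact Real.log_le_log (by linarith) h

theorem aux_bound1 (G : ℝ → ℝ) (hG : ∀ x, x ≠ 0 → ContDiffAt ℝ 4 G x)
    (h1 : ∀ x, |x| ≤ 1 → G x = -Real.log x) (h2 : ∀ x, 2 ≤ |x| → G x = 0) (n : ℕ) (hn : n < 4) :
    ∃ M : ℝ, 0 ≤ M ∧ ∀ x, x ≠ 0 → |iteratedDeriv (n + 1) G x| * |x| ^ (n + 1) ≤ M := by
  have hc : ContinuousOn (iteratedDeriv (n + 1) G) {0}ᶜ := by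
    have hon : ContDiffOn ℝ 4 G {0}ᶜ := fun x hx => (hG x hx).contDiffWithinAt
    have := hon.continuousOn_iteratedDerivWithin (m := n + 1) (by exact_mod_cast hn)
      isOpen_compl_singleton.uniqueDiffOn
    exact this.congr (fun x hx => (iteratedDerivWithin_of_isOpen isOpen_compl_singleton hx).symm)
  have hK : IsCompact (Metric.closedBall (0 : ℝ) 3 ∩ {x | 1 / 2 ≤ |x|}) :=
    (isCompact_closedBall _ _).inter_right (isClosed_le continuous_const continuous_abs)
  obtain ⟨M, hM⟩ := hK.exists_bound_of_continuousOn
    (f := fun x => iteratedDeriv (n + 1) G x * x ^ (n + 1)) (by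
      apply ContinuousOn.mul _ (by fun_prop)
      apply hc.mono
      rintro x ⟨-, hx⟩ rfl
      norm_num at hx)
  refine ⟨max (max M 0) |iteratedDeriv (n + 1) Real.log 1|, by simp, fun x hx => ?_⟩
  rw [← abs_pow, ← abs_mul]
  by_cases ha : |x| < 1
  · apply le_max_of_le_right
    have : G =ᶠ[𝓝 x] fun y => -Real.log y := by
      filter_upwards [(isOpen_lt continuous_abs continuous_const).mem_nhds ha] with y hy
      exact h1 y (le_of_lt hy)
    rw [this.iteratedDeriv_eq, iteratedDeriv_fun_neg, ← aux_iter_log n x hx, neg_mul, abs_neg,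
      mul_comm]
  · apply le_max_of_le_left
    by_cases hb : |x| ≤ 3
    · apply le_max_of_le_left
      exact hM x ⟨by simpa using hb, by simp only [Set.mem_ofPred_eq]; linarith⟩
    · apply le_max_of_le_right
      have : G =ᶠ[𝓝 x] fun y => 0 := by
        filter_upwards [(isOpen_lt continuous_const continuous_abs).mem_nhds (not_le.1 hb)]
          with y hy
        exact h2 y (by linarith)
      rw [this.iteratedDeriv_eq]
      simp

theorem aux_bound (G : ℝ → ℝ) (hG : ∀ x, x ≠ 0 → ContDiffAt ℝ 4 G x)
    (h1 : ∀ x, |x| ≤ 1 → G x = -Real.log x) (h2 : ∀ x, 2 ≤ |x| → G x = 0) :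
    ∃ M : ℝ, 0 ≤ M ∧ ∀ n < 4, ∀ x, x ≠ 0 → |iteratedDeriv (n + 1) G x| * |x| ^ (n + 1) ≤ M := by
  have := fun n : Fin 4 => aux_bound1 G hG h1 h2 n n.2
  choose M hM0 hM using this
  refine ⟨∑ i, M i, Finset.sum_nonneg fun i _ => hM0 i, fun n hn x hx => ?_⟩
  exact (hM ⟨n, hn⟩ x hx).trans
    (Finset.single_le_sum (f := M) (fun i _ => hM0 i) (Finset.mem_univ _))


/-- **Truncations of the logarithmic kernel.** There is an absolute constant `C₀` and a
family of truncated kernels `log_{ε,R}` (with associated constants `C_R` depending only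
on `R`) satisfying all the properties of Lemma `truncationLemma`. -/
theorem truncated_log_kernel :
    ∃ C₀ : ℝ, 1 ≤ C₀ ∧
    ∃ L : ℝ → ℝ → ℝ → ℝ, ∃ Cc : ℝ → ℝ,
      ∀ ε R : ℝ, 0 < ε → ε ≤ 1 → 1 ≤ R →
        (|Cc R| ≤ C₀ * (1 + Real.log R)) ∧
        ContDiffOn ℝ 4 (L ε R) ({0}ᶜ : Set ℝ) ∧
        (∃ K : NNReal, LipschitzWith K (L ε R)) ∧
        (∀ x : ℝ, 2 * R < |x| → L ε R x = 0) ∧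
        (∀ x : ℝ, ε ≤ |x| → |x| ≤ R → L ε R x = -Real.log |x| + Cc R) ∧
        (∀ x : ℝ, R < |x| → |L ε R x| ≤ C₀ * (1 + Real.log R)) ∧
        (∀ x : ℝ, |x| ≤ ε → |L ε R x - Cc R| ≤ C₀ * (1 + Real.log (1 / ε))) ∧
        (∀ x : ℝ, x ≠ 0 → deriv (L ε R) (-x) = -deriv (L ε R) x) ∧
        ContDiffOn ℝ 3 (deriv (L ε R)) ({0}ᶜ : Set ℝ) ∧
        (∀ x : ℝ, 2 * R < |x| → deriv (L ε R) x = 0) ∧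
        (∀ x : ℝ, x ≠ 0 → |deriv (L ε R) x| ≤ C₀ / ε) ∧
        (∀ j : ℕ, j ≤ 3 → ∀ x : ℝ, x ≠ 0 →
          |iteratedDeriv j (deriv (L ε R)) x| ≤ C₀ / |x| ^ (1 + j)) ∧
        (∀ ε' : ℝ, 0 < ε' → ε' ≤ 1 → ∀ x : ℝ, R < |x| → L ε R x = L ε' R x) ∧
        (∀ R' : ℝ, 1 ≤ R' → ∀ x : ℝ, |x| ≤ ε → L ε R x - Cc R = L ε R' x - Cc R') := by
  obtain ⟨G, hG, hev, h1, h2, hb⟩ := aux_G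
  obtain ⟨M, hM0, hM⟩ := aux_bound G hG h1 h2
  have hl2 : 0 < Real.log 2 := Real.log_pos (by norm_num)
  have hl21 : Real.log 2 ≤ 1 := by linarith [Real.log_two_lt_d9]
  refine ⟨4 * M + 2, by linarith, fun ε R x => if x = 0 then Real.log R - Real.log (ε / 2)
    else G (R⁻¹ * x) - G ((ε / 2)⁻¹ * x), fun R => Real.log R, ?_⟩
  intro ε R hε hε1 hR
  beta_reduce
  have hR0 : 0 < R := by linarith
  have hlR : 0 ≤ Real.log R := Real.log_nonneg hR
  have hd : 0 < ε / 2 := by linarith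
  have hle : Real.log (ε / 2) = Real.log ε - Real.log 2 :=
    Real.log_div hε.ne' (by norm_num)
  have hlε : Real.log ε ≤ 0 := Real.log_nonpos hε.le hε1
  have hscale : ∀ r x : ℝ, 0 < r → |r⁻¹ * x| = |x| / r := by
    intro r x hr
    rw [abs_mul, abs_of_pos (inv_pos.2 hr)]; field_simp
  -- values of the two pieces
  have hin : ∀ r x : ℝ, 0 < r → x ≠ 0 → |x| ≤ r → G (r⁻¹ * x) = Real.log r - Real.log |x| := by
    intro r x hr hx hxr
    rw [h1 _ (by rw [hscale r x hr, div_le_one hr]; exact hxr),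
      Real.log_mul (inv_ne_zero hr.ne') hx, Real.log_inv, Real.log_abs]
    ring
  have hout : ∀ r x : ℝ, 0 < r → 2 * r ≤ |x| → G (r⁻¹ * x) = 0 := by
    intro r x hr hxr
    exact h2 _ (by rw [hscale r x hr, le_div_iff₀ hr]; exact hxr)
  have hmid : ∀ r x : ℝ, 0 < r → r ≤ |x| → |G (r⁻¹ * x)| ≤ Real.log 2 := by
    intro r x hr hxr
    exact hb _ (by rw [hscale r x hr, le_div_iff₀ hr, one_mul]; exact hxr)
  have hne : ∀ r x : ℝ, 0 < r → r ≤ |x| → x ≠ 0 := by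
    rintro r x hr hx rfl
    simp at hx; linarith
  have hsm : ∀ r x : ℝ, 0 < r → x ≠ 0 → ContDiffAt ℝ 4 (fun x => G (r⁻¹ * x)) x := by
    intro r x hr hx
    exact (hG (r⁻¹ * x) (mul_ne_zero (inv_ne_zero hr.ne') hx)).comp x
      (contDiffAt_const.mul contDiffAt_id)
  have hbd : ∀ r x : ℝ, 0 < r → x ≠ 0 → ∀ n < 4,
      |iteratedDeriv (n + 1) (fun x => G (r⁻¹ * x)) x| ≤ M / |x| ^ (n + 1) := by
    intro r x hr hx n hn
    rw [aux_iter_scale]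
    have := hM n hn (r⁻¹ * x) (mul_ne_zero (inv_ne_zero hr.ne') hx)
    rw [le_div_iff₀ (by positivity)]
    refine le_trans (le_of_eq ?_) this
    rw [abs_mul, abs_mul, abs_pow, mul_pow]
    ring
  have hLfar : ∀ x : ℝ, ε ≤ |x| → (if x = 0 then Real.log R - Real.log (ε / 2)
      else G (R⁻¹ * x) - G ((ε / 2)⁻¹ * x)) = G (R⁻¹ * x) := by
    intro x hx
    rw [if_neg (hne ε x hε hx), hout (ε / 2) x hd (by linarith), sub_zero]
  have hLnear : ∀ x : ℝ, |x| ≤ ε / 2 → (if x = 0 then Real.log R - Real.log (ε / 2)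
      else G (R⁻¹ * x) - G ((ε / 2)⁻¹ * x)) = Real.log R - Real.log (ε / 2) := by
    intro x hx
    split_ifs with h
    · rfl
    · rw [hin R x hR0 h (by linarith), hin _ x hd h hx]; ring
  have hLabs : ∀ R' : ℝ, 1 ≤ R' → ∀ x : ℝ, |x| ≤ ε → (if x = 0 then Real.log R' - Real.log (ε / 2)
      else G (R'⁻¹ * x) - G ((ε / 2)⁻¹ * x)) - Real.log R' = 
      if x = 0 then - Real.log (ε / 2) else - Real.log |x| - G ((ε / 2)⁻¹ * x) := by
    intro R' hR' x hx
    split_ifs with h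
    · ring
    · rw [hin R' x (by linarith) h (by linarith)]; ring
  set L : ℝ → ℝ := fun x => if x = 0 then Real.log R - Real.log (ε / 2)
    else G (R⁻¹ * x) - G ((ε / 2)⁻¹ * x) with hL
  have hLev : ∀ x, x ≠ 0 → L =ᶠ[𝓝 x] ((fun x => G (R⁻¹ * x)) - (fun x => G ((ε / 2)⁻¹ * x))) := by
    intro x hx
    filter_upwards [isOpen_ne.mem_nhds hx] with y hy
    simp only [hL, Pi.sub_apply]
    exact if_neg hy
  have hLconst : ∀ x, |x| < ε / 2 → L =ᶠ[𝓝 x] fun _ => Real.log R - Real.log (ε / 2) := by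
    intro x hx
    filter_upwards [(isOpen_lt continuous_abs continuous_const).mem_nhds hx] with y hy
    exact hLnear y (le_of_lt hy)
  have hLsm : ContDiff ℝ 4 L := by
    rw [contDiff_iff_contDiffAt]
    intro x
    by_cases hx : x = 0
    · exact contDiffAt_const.congr_of_eventuallyEq (hLconst x (by simpa [hx] using hε))
    · exact ((hsm R x hR0 hx).sub (hsm _ x hd hx)).congr_of_eventuallyEq (hLev x hx)
  have hL0 : ∀ x : ℝ, 2 * R ≤ |x| → L x = 0 := by
    intro x hx
    exact (hLfar x (by linarith)).trans (hout R x hR0 hx)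
  have hjb : ∀ j : ℕ, j ≤ 3 → ∀ x : ℝ, x ≠ 0 →
      |iteratedDeriv j (deriv L) x| ≤ (2 * M) / |x| ^ (1 + j) := by
    intro j hj x hx
    rw [← iteratedDeriv_succ', (hLev x hx).iteratedDeriv_eq, iteratedDeriv_sub]
    · refine (abs_sub _ _).trans ((add_le_add (hbd R x hR0 hx j (by omega))
        (hbd _ x hd hx j (by omega))).trans (le_of_eq ?_))
      rw [add_comm 1 j]; ring
    · exact (hsm R x hR0 hx).of_le (by exact_mod_cast Nat.succ_le_succ hj)
    · exact (hsm _ x hd hx).of_le (by exact_mod_cast Nat.succ_le_succ hj)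
  have hkb : ∀ x : ℝ, |deriv L x| ≤ (4 * M + 2) / ε := by
    intro x
    by_cases hx : |x| < ε / 2
    · rw [(hLconst x hx).deriv_eq, deriv_const, abs_zero]; positivity
    · have hx' := not_lt.1 hx
      have := hjb 0 (by norm_num) x (hne _ x hd hx')
      simp only [iteratedDeriv_zero, add_zero, pow_one] at this
      refine this.trans ?_
      rw [div_le_div_iff₀ (by linarith) hε]
      nlinarith
  have hdsm : ContDiff ℝ 3 (deriv L) := by
    have : ContDiff ℝ (3 + 1) L := by norm_num; exact hLsm
    exact (contDiff_succ_iff_deriv.1 this).2.2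
  refine ⟨?_, hLsm.contDiffOn, ?_, fun x hx => hL0 x hx.le, ?_, ?_, ?_, ?_, hdsm.contDiffOn, ?_,
    fun x _ => hkb x, ?_, ?_, ?_⟩
  · rw [abs_of_nonneg hlR]; nlinarith
  · refine ⟨⟨(4 * M + 2) / ε, by positivity⟩, lipschitzWith_of_nnnorm_deriv_le
      (hLsm.differentiable (by norm_num)) fun x => ?_⟩
    exact hkb x
  · intro x hx hxR
    rw [hLfar x hx, hin R x hR0 (hne _ x hε hx) hxR]; ring
  · intro x hx
    rw [hLfar x (by linarith)]
    have := hmid R x hR0 hx.le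
    nlinarith
  · intro x hx
    have h3 := hLabs R hR x hx
    have h4 : L x - Real.log R = _ := h3
    rw [h4, one_div, Real.log_inv]
    have key : Real.log 2 + Real.log 2 - Real.log ε ≤ (4 * M + 2) * (1 + -Real.log ε) := by
      nlinarith
    refine le_trans ?_ key
    by_cases hx2 : |x| ≤ ε / 2
    · have h5 : L x = _ := hLnear x hx2
      rw [← h4, h5, hle, abs_le]
      constructor <;> linarith
    · have hx2' := (not_le.1 hx2).le
      have h6 := hmid _ x hd hx2'
      rw [if_neg (hne _ x hd hx2')]
      have h7 := Real.log_le_log hd hx2'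
      have h8 : Real.log |x| ≤ 0 := Real.log_nonpos (abs_nonneg x) (by linarith)
      rw [abs_le] at h6 ⊢
      constructor <;> linarith [h6.1, h6.2]
  · intro x _
    have he : (fun x => L (-x)) = L := by
      funext y
      simp only [hL, neg_eq_zero, mul_neg, hev]
    have := deriv_comp_neg L x
    rw [he] at this
    linarith
  · intro x hx
    have : L =ᶠ[𝓝 x] fun _ => 0 := by
      filter_upwards [(isOpen_lt continuous_const continuous_abs).mem_nhds hx] with y hy
      exact hL0 y (le_of_lt hy)
    rw [this.deriv_eq, deriv_const]
  · intro j hj x hx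
    refine (hjb j hj x hx).trans ?_
    gcongr
    linarith
  · intro ε' hε' hε1' x hx
    rw [hLfar x (by linarith), if_neg (hne _ x hR0 hx.le),
      hout (ε' / 2) x (by linarith) (by linarith), sub_zero]
  · intro R' hR' x hx
    rw [hLabs R' hR' x hx]
    exact hLabs R hR x hx
end

section
/- Let d ≥ 2 and let ψ : ℝ → ℝ be a smooth nonnegative function supported in [-1,1] with ∫ψ = 1; for r > 0 set ψ_r(y) = r^{-1}ψ(y/r). There exists δ₁ > 0, depending only on d and ψ, with the following property. Let A : ℝ → ℝ^{d-1} be Lipschitz with Lip(A) ≤ δ₁, let A' denote its almost-everywhere defined derivative, and for x ≠ y define P(x,y) = -log |(x-y, (x-y)·(A' * ψ_{|x-y|})(x))|, where (A' * ψ_r)(x) ∈ ℝ^{d-1} is the componentwise convolution of A' with ψ_r, and the argument of the norm is the vector in ℝ^d whose first coordinate is x-y and whose remaining d-1 coordinates are the entries of (A' * ψ_{|x-y|})(x) each multiplied by (x-y). Then for every y ∈ ℝ the function x ↦ P(x,y) is twice differentiable on ℝ∖{y} with ∂²_x P(x,y) ≥ 0, and for every x ∈ ℝ the function y ↦ P(x,y)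 is twice differentiable on ℝ∖{x} with ∂²_y P(x,y) ≥ 0. -/
open MeasureTheory

/-- The point `(t, w) ∈ ℝ^d` with first coordinate `t ∈ ℝ` and remaining coordinates
`w ∈ ℝ^{d-1}`. -/
noncomputable def graphPoint (d : ℕ) (t : ℝ) (w : EuclideanSpace ℝ (Fin (d - 1))) :
    EuclideanSpace ℝ (Fin d) :=
  (EuclideanSpace.equiv (Fin d) ℝ).symm
    (fun i => if h : (i : ℕ) = 0 then t else w ⟨(i : ℕ) - 1, by have h2 := i.isLt; omega⟩)

/-- The standard approximate identity `ψ_r(y) = r⁻¹ ψ(y/r)`. -/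
noncomputable def mollifier (ψ : ℝ → ℝ) (r x : ℝ) : ℝ := r⁻¹ * ψ (x / r)

/-- The componentwise convolution `(A' * ψ_r)(x)` of the (a.e. defined) derivative of `A`
with the approximate identity `ψ_r`. -/
noncomputable def derivMollified (d : ℕ) (ψ : ℝ → ℝ)
    (A : ℝ → EuclideanSpace ℝ (Fin (d - 1))) (r x : ℝ) :
    EuclideanSpace ℝ (Fin (d - 1)) :=
  ∫ z : ℝ, mollifier ψ r (x - z) • deriv A z

/-- The principal kernel `P(x,y) = -log |(x-y, ∇A_{|x-y|}(x)(x-y))|`. -/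
noncomputable def principalKernel (d : ℕ) (ψ : ℝ → ℝ)
    (A : ℝ → EuclideanSpace ℝ (Fin (d - 1))) (x y : ℝ) : ℝ :=
  -Real.log ‖graphPoint d (x - y) ((x - y) • derivMollified d ψ A |x - y| x)‖

/-- mollification with profile `φ` at scale `r` around `c`. -/
noncomputable def mollH {E : Type*} [NormedAddCommGroup E] [NormedSpace ℝ E]
    (φ : ℝ → ℝ) (B : ℝ → E) (c r : ℝ) : E :=
  ∫ z : ℝ, (r⁻¹ * φ ((c - z) / r)) • B z

/-- profile of the scaled derivative. -/
noncomputable def profD (φ : ℝ → ℝ) : ℝ → ℝ := fun t => -φ t - t * deriv φ t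

/-- smooth with bounded support -/
def GoodProf (φ : ℝ → ℝ) : Prop :=
  ContDiff ℝ ((⊤ : ℕ∞) : WithTop ℕ∞) φ ∧ HasCompactSupport φ

lemma GoodProf.profD {φ : ℝ → ℝ} (h : GoodProf φ) : GoodProf (profD φ) := by
  obtain ⟨h1, h2⟩ := h
  have h3 : ContDiff ℝ ((⊤ : ℕ∞) : WithTop ℕ∞) (deriv φ) := by
    exact (contDiff_infty_iff_deriv.1 h1).2
  refine ⟨?_, ?_⟩
  · unfold _root_.profD
    exact h1.neg.sub (contDiff_id.mul h3)
  · have h4 : HasCompactSupport (fun t => t * deriv φ t) := h2.deriv.mul_left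
    have h5 : HasCompactSupport (fun t => -φ t) := h2.neg
    exact h5.sub h4

lemma GoodProf.shift {φ : ℝ → ℝ} (h : GoodProf φ) (s : ℝ) : GoodProf (fun t => φ (s + t)) := by
  obtain ⟨h1, h2⟩ := h
  refine ⟨h1.comp (contDiff_const.add contDiff_id), ?_⟩
  exact h2.comp_homeomorph (Homeomorph.addLeft s)

lemma GoodProf.bounds {φ : ℝ → ℝ} (h : GoodProf φ) :
    ∃ M R : ℝ, 0 ≤ M ∧ 0 < R ∧ (∀ t, |φ t| ≤ M) ∧ ∀ t, R < |t| → φ t = 0 := by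
  obtain ⟨h1, h2⟩ := h
  obtain ⟨M, hM⟩ := h2.exists_bound_of_continuous h1.continuous
  obtain ⟨R, hR⟩ := h2.isBounded.subset_closedBall (0 : ℝ)
  refine ⟨M, max R 1, (norm_nonneg _).trans (hM 0), by positivity, hM, ?_⟩
  intro t ht
  by_contra hne
  have := hR (subset_tsupport _ hne)
  simp only [Metric.mem_closedBall, dist_zero_right, Real.norm_eq_abs] at this
  exact absurd (this.trans (le_max_left R 1)) (not_le.2 ht)

section
variable {E : Type*} [NormedAddCommGroup E] [NormedSpace ℝ E]

lemma GoodProf.int_scaled {φ : ℝ → ℝ} (h : GoodProf φ) (c : ℝ) {r : ℝ} (hr : 0 < r) :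
    Integrable (fun z : ℝ => r⁻¹ * φ ((c - z) / r)) := by
  have h0 : Integrable φ := h.1.continuous.integrable_of_hasCompactSupport h.2
  have h1 : Integrable (fun z => φ (z / r)) := h0.comp_div hr.ne'
  exact (h1.comp_sub_left c).const_mul _

lemma mollH_bound {φ : ℝ → ℝ} (h : GoodProf φ) {B : ℝ → E} {δ : ℝ} (hB : ∀ z, ‖B z‖ ≤ δ)
    (c : ℝ) {r : ℝ} (hr : 0 < r) : ‖mollH φ B c r‖ ≤ (∫ t, |φ t|) * δ := by
  have hi := (h.int_scaled c hr).norm.mul_const δ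
  have h1 : ‖mollH φ B c r‖ ≤ ∫ z, ‖r⁻¹ * φ ((c - z) / r)‖ * δ := by
    refine norm_integral_le_of_norm_le hi (Filter.Eventually.of_forall fun z => ?_)
    rw [norm_smul]
    exact mul_le_mul_of_nonneg_left (hB z) (norm_nonneg _)
  refine h1.trans (le_of_eq ?_)
  rw [integral_mul_const]
  congr 1
  have h2 : ∀ z, ‖r⁻¹ * φ ((c - z) / r)‖ = r⁻¹ * (fun w => |φ (w / r)|) (c - z) := by
    intro z
    rw [norm_mul, Real.norm_eq_abs, Real.norm_eq_abs, abs_of_pos (inv_pos.2 hr)]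
  simp_rw [h2]
  rw [integral_const_mul, integral_sub_left_eq_self (fun w => |φ (w / r)|) volume c,
    Measure.integral_comp_div (fun t => |φ t|) r, abs_of_pos hr, smul_eq_mul,
    inv_mul_cancel_left₀ hr.ne']

lemma mollH_hasDerivAt {φ : ℝ → ℝ} (h : GoodProf φ) {B : ℝ → E} {δ : ℝ}
    (hB : ∀ z, ‖B z‖ ≤ δ) (hBm : AEStronglyMeasurable B volume)
    (c : ℝ) {r : ℝ} (hr : 0 < r) :
    HasDerivAt (mollH φ B c) (r⁻¹ • mollH (profD φ) B c r) r := by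
  obtain ⟨M, R, hM0, hR0, hM, hR⟩ := h.profD.bounds
  have hδ : 0 ≤ δ := (norm_nonneg _).trans (hB 0)
  have hm : ∀ φ : ℝ → ℝ, GoodProf φ → ∀ r : ℝ,
      AEStronglyMeasurable (fun z : ℝ => (r⁻¹ * φ ((c - z) / r)) • B z) volume := by
    intro φ h r
    have hc := h.1.continuous
    have : Continuous (fun z : ℝ => r⁻¹ * φ ((c - z) / r)) := by fun_prop
    exact this.aestronglyMeasurable.smul hBm
  have key := hasDerivAt_integral_of_dominated_loc_of_deriv_le (μ := (volume : Measure ℝ))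
    (F := fun r z => (r⁻¹ * φ ((c - z) / r)) • B z)
    (F' := fun r z => r⁻¹ • ((r⁻¹ * profD φ ((c - z) / r)) • B z))
    (x₀ := r) (s := Metric.ball r (r / 2))
    (bound := Set.indicator (Set.Icc (c - R * (2 * r)) (c + R * (2 * r)))
      (fun _ => (r / 2)⁻¹ * ((r / 2)⁻¹ * M * δ)))
    (Metric.ball_mem_nhds r (by positivity)) ?_ ?_ ?_ ?_ ?_ ?_
  · have := key.2
    rw [integral_smul] at this
    exact this
  · exact Filter.Eventually.of_forall fun r => hm φ h r
  · refine ((h.int_scaled c hr).norm.mul_const δ).mono' (hm φ h r)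
      (Filter.Eventually.of_forall fun z => ?_)
    rw [norm_smul]
    exact mul_le_mul_of_nonneg_left (hB z) (norm_nonneg _)
  · exact (hm _ h.profD r).const_smul _
  · refine Filter.Eventually.of_forall fun z ρ hρ => ?_
    rw [Metric.mem_ball, Real.dist_eq, abs_lt] at hρ
    have hρ1 : r / 2 < ρ := by linarith
    have hρ2 : ρ < 2 * r := by linarith
    have hρ0 : 0 < ρ := by linarith
    by_cases hz : z ∈ Set.Icc (c - R * (2 * r)) (c + R * (2 * r))
    · rw [Set.indicator_of_mem hz, norm_smul, norm_smul, norm_mul, Real.norm_eq_abs,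
        Real.norm_eq_abs, abs_of_pos (inv_pos.2 hρ0)]
      have := hM ((c - z) / ρ)
      have := hB z
      have : ρ⁻¹ ≤ (r / 2)⁻¹ := inv_anti₀ (by positivity) hρ1.le
      gcongr
    · rw [Set.indicator_of_notMem hz, hR, mul_zero, zero_smul, smul_zero, norm_zero]
      rw [abs_div, abs_of_pos hρ0, lt_div_iff₀ hρ0]
      have h1 : R * ρ < R * (2 * r) := by gcongr
      refine h1.trans ?_
      by_contra hcon
      have := abs_le.1 (not_lt.1 hcon)
      exact hz ⟨by linarith, by linarith⟩
  · exact (integrable_indicator_iff measurableSet_Icc).2 (integrableOn_const (by simp))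
  · refine Filter.Eventually.of_forall fun z ρ hρ => ?_
    rw [Metric.mem_ball, Real.dist_eq, abs_lt] at hρ
    have hρ0 : ρ ≠ 0 := by intro h0; subst h0; linarith
    rw [smul_smul]
    refine HasDerivAt.smul_const ?_ (B z)
    have hφ : HasDerivAt φ (deriv φ ((c - z) / ρ)) ((c - z) / ρ) :=
      ((h.1.differentiable (by simp)) _).hasDerivAt
    have hd : HasDerivAt (fun ρ : ℝ => (c - z) / ρ) (-(c - z) / ρ ^ 2) ρ := by
      refine ((hasDerivAt_inv hρ0).const_mul (c - z)).congr_deriv ?_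
      field_simp
    have := (hasDerivAt_inv hρ0).mul (hφ.comp ρ hd)
    refine this.congr_deriv ?_
    simp only [profD, Function.comp]
    field_simp
    ring
end

section
variable {E : Type*} [NormedAddCommGroup E] [InnerProductSpace ℝ E]

lemma kernel_main {H0 H1 H2 : ℝ → E} {ε : ℝ} (hε : 0 ≤ ε) (hε1 : 3 * ε ^ 2 ≤ 1)
    (h01 : ∀ r, 0 < r → HasDerivAt H0 (r⁻¹ • H1 r) r)
    (h12 : ∀ r, 0 < r → HasDerivAt H1 (r⁻¹ • H2 r) r)
    (b0 : ∀ r, 0 < r → ‖H0 r‖ ≤ ε) (b1 : ∀ r, 0 < r → ‖H1 r‖ ≤ ε)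
    (b2 : ∀ r, 0 < r → ‖H2 r‖ ≤ ε) :
    ∃ Q1 Q2 : ℝ → ℝ, (∀ r, 0 < r →
      HasDerivAt (fun r => -Real.log r - (1 / 2) * Real.log (1 + ‖H0 r‖ ^ 2)) (Q1 r) r ∧
      HasDerivAt Q1 (Q2 r) r ∧ 0 ≤ Q2 r) := by
  refine ⟨fun r => -(r⁻¹ * (1 + inner ℝ (H0 r) (H1 r) / (1 + ‖H0 r‖ ^ 2))),
    fun r => (r ^ 2)⁻¹ * (1 + inner ℝ (H0 r) (H1 r) / (1 + ‖H0 r‖ ^ 2)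
      - (‖H1 r‖ ^ 2 + inner ℝ (H0 r) (H2 r)) / (1 + ‖H0 r‖ ^ 2)
      + 2 * (inner ℝ (H0 r) (H1 r)) ^ 2 / (1 + ‖H0 r‖ ^ 2) ^ 2), fun r hr => ?_⟩
  have hN : 0 < 1 + ‖H0 r‖ ^ 2 := by positivity
  have dN : HasDerivAt (fun r => 1 + ‖H0 r‖ ^ 2) (2 * (r⁻¹ * inner ℝ (H0 r) (H1 r))) r := by
    have := ((h01 r hr).norm_sq).const_add 1
    rwa [inner_smul_right] at this
  have dp : HasDerivAt (fun r => inner ℝ (H0 r) (H1 r))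
      (r⁻¹ * (‖H1 r‖ ^ 2 + inner ℝ (H0 r) (H2 r))) r := by
    have := (h01 r hr).inner ℝ (h12 r hr)
    refine this.congr_deriv ?_
    rw [inner_smul_right, inner_smul_left, real_inner_self_eq_norm_sq]
    simp only [conj_trivial]
    ring
  refine ⟨?_, ?_, ?_⟩
  · refine ((Real.hasDerivAt_log hr.ne').neg.sub ((dN.log hN.ne').const_mul (1 / 2))).congr_deriv ?_
    field_simp
    ring
  · refine (((hasDerivAt_inv hr.ne').mul ((dp.div dN hN.ne').const_add 1)).neg).congr_deriv ?_
    simp only [Pi.div_apply]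
    field_simp
    ring
  · have e1 : |inner ℝ (H0 r) (H1 r)| ≤ ε * ε := (abs_real_inner_le_norm _ _).trans
      (mul_le_mul (b0 r hr) (b1 r hr) (norm_nonneg _) hε)
    have e2 : |inner ℝ (H0 r) (H2 r)| ≤ ε * ε := (abs_real_inner_le_norm _ _).trans
      (mul_le_mul (b0 r hr) (b2 r hr) (norm_nonneg _) hε)
    have e3 : ‖H1 r‖ ^ 2 ≤ ε ^ 2 := pow_le_pow_left₀ (norm_nonneg _) (b1 r hr) 2
    have e1' := abs_le.1 e1
    have e2' := abs_le.1 e2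
    refine mul_nonneg (by positivity) (add_nonneg ?_ (by positivity))
    rw [add_sub_assoc, ← sub_div, ← neg_le_iff_add_nonneg', ← neg_le_neg_iff, neg_neg, ← neg_div,
      div_le_one hN]
    nlinarith [sq_nonneg ‖H0 r‖]
end

lemma transfer {f Q Q1 Q2 : ℝ → ℝ} {s c : ℝ} (hs : s * s = 1)
    (hQ : ∀ r, 0 < r → HasDerivAt Q (Q1 r) r ∧ HasDerivAt Q1 (Q2 r) r ∧ 0 ≤ Q2 r)
    (hf : ∀ x, 0 < s * (x - c) → f x = Q (s * (x - c))) {x : ℝ} (hx : 0 < s * (x - c)) :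
    DifferentiableAt ℝ f x ∧ DifferentiableAt ℝ (deriv f) x ∧ 0 ≤ deriv (deriv f) x := by
  have hopen : ∀ x, 0 < s * (x - c) → ∀ᶠ w in nhds x, 0 < s * (w - c) := fun x hx =>
    (isOpen_lt continuous_const (by fun_prop)).mem_nhds hx
  have hl : ∀ x, HasDerivAt (fun w => s * (w - c)) s x := fun x => by
    simpa using ((hasDerivAt_id x).sub_const c).const_mul s
  have h1 : ∀ x, 0 < s * (x - c) → HasDerivAt f (Q1 (s * (x - c)) * s) x := fun x hx =>
    (((hQ _ hx).1).comp x (hl x)).congr_of_eventuallyEq ((hopen x hx).mono hf)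
  have h2 : HasDerivAt (deriv f) (Q2 (s * (x - c))) x := by
    have := (((hQ _ hx).2.1).comp x (hl x)).mul_const s
    rw [mul_assoc, hs, mul_one] at this
    exact this.congr_of_eventuallyEq ((hopen x hx).mono fun w hw => (h1 w hw).deriv)
  exact ⟨(h1 x hx).differentiableAt, h2.differentiableAt, by rw [h2.deriv]; exact (hQ _ hx).2.2⟩

lemma graphPoint_norm {d : ℕ} (hd : 2 ≤ d) (t : ℝ) (w : EuclideanSpace ℝ (Fin (d - 1))) :
    ‖graphPoint d t w‖ = Real.sqrt (t ^ 2 + ‖w‖ ^ 2) := by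
  obtain ⟨n, rfl⟩ : ∃ n, d = n + 1 := ⟨d - 1, by omega⟩
  rw [EuclideanSpace.norm_eq, EuclideanSpace.norm_sq_eq, Fin.sum_univ_succ]
  simp [graphPoint]

lemma kernel_eq {d : ℕ} (hd : 2 ≤ d) (u r : ℝ) (hr : 0 < r) (hu : u ^ 2 = r ^ 2)
    (w : EuclideanSpace ℝ (Fin (d - 1))) :
    -Real.log ‖graphPoint d u (u • w)‖ = -Real.log r - (1 / 2) * Real.log (1 + ‖w‖ ^ 2) := by
  rw [graphPoint_norm hd, norm_smul, mul_pow, Real.norm_eq_abs, sq_abs, hu,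
    Real.log_sqrt (by positivity), show r ^ 2 + r ^ 2 * ‖w‖ ^ 2 = r ^ 2 * (1 + ‖w‖ ^ 2) by ring,
    Real.log_mul (by positivity) (by positivity), Real.log_pow]
  push_cast
  ring

/-- **Convexity of the principal kernel.** If `Lip(A)` is small enough (depending only on
`d` and `ψ`), then `∂²_x P(x,y) ≥ 0` and `∂²_y P(x,y) ≥ 0` off the diagonal. -/
theorem principalKernel_convex (d : ℕ) (hd : 2 ≤ d) (ψ : ℝ → ℝ)
    (hψ : ContDiff ℝ ((⊤ : ℕ∞) : WithTop ℕ∞) ψ) (hψ0 : ∀ x, 0 ≤ ψ x)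
    (hψsupp : ∀ x : ℝ, x ∉ Set.Icc (-1 : ℝ) 1 → ψ x = 0)
    (hψint : ∫ x : ℝ, ψ x = 1) :
    ∃ δ₁ : ℝ, 0 < δ₁ ∧
      ∀ A : ℝ → EuclideanSpace ℝ (Fin (d - 1)),
        (∀ s t : ℝ, dist (A s) (A t) ≤ δ₁ * dist s t) →
        (∀ y x : ℝ, x ≠ y →
          DifferentiableAt ℝ (fun x' => principalKernel d ψ A x' y) x ∧
          DifferentiableAt ℝ (deriv fun x' => principalKernel d ψ A x' y) x ∧
          0 ≤ deriv (deriv fun x' => principalKernel d ψ A x' y) x) ∧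
        (∀ x y : ℝ, y ≠ x →
          DifferentiableAt ℝ (fun y' => principalKernel d ψ A x y') y ∧
          DifferentiableAt ℝ (deriv fun y' => principalKernel d ψ A x y') y ∧
          0 ≤ deriv (deriv fun y' => principalKernel d ψ A x y') y) := by
  have good : GoodProf ψ := by
    refine ⟨hψ, HasCompactSupport.intro (isCompact_Icc (a := (-1 : ℝ)) (b := 1)) ?_⟩
    intro x hx
    exact hψsupp x hx
  have hK : ∀ s : ℝ, ∃ K : ℝ, 0 ≤ K ∧ (∫ t, |ψ (s + t)|) ≤ K ∧
      (∫ t, |profD (fun t => ψ (s + t)) t|) ≤ K ∧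
      (∫ t, |profD (profD (fun t => ψ (s + t))) t|) ≤ K := by
    intro s
    refine ⟨(∫ t, |ψ (s + t)|) + (∫ t, |profD (fun t => ψ (s + t)) t|) +
      (∫ t, |profD (profD (fun t => ψ (s + t))) t|), ?_, ?_, ?_, ?_⟩ <;>
    have h1 : 0 ≤ ∫ t, |ψ (s + t)| := integral_nonneg fun _ => abs_nonneg _ <;>
    have h2 : 0 ≤ ∫ t, |profD (fun t => ψ (s + t)) t| := integral_nonneg fun _ => abs_nonneg _ <;>
    have h3 : 0 ≤ ∫ t, |profD (profD (fun t => ψ (s + t))) t| :=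
      integral_nonneg fun _ => abs_nonneg _ <;>
    linarith
  choose K hK0 hKa hKb hKc using hK
  set L : ℝ := K 0 + K 1 + K (-1) + 1 with hL
  have hL0 : 0 < L := by have := hK0 0; have := hK0 1; have := hK0 (-1); linarith
  refine ⟨1 / (2 * L), by positivity, fun A hA => ?_⟩
  have hB : ∀ z, ‖deriv A z‖ ≤ 1 / (2 * L) := by
    intro z
    have hl : LipschitzWith (Real.toNNReal (1 / (2 * L))) A := LipschitzWith.of_dist_le_mul
      fun x y => by rw [Real.coe_toNNReal _ (by positivity)]; exact hA x y
    have := norm_deriv_le_of_lipschitz hl (x₀ := z)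
    rwa [Real.coe_toNNReal _ (by positivity)] at this
  have hBm : AEStronglyMeasurable (deriv A) volume :=
    (stronglyMeasurable_deriv A).aestronglyMeasurable
  have main : ∀ s : ℝ, K s ≤ L → ∀ c : ℝ, ∃ Q1 Q2 : ℝ → ℝ, (∀ r, 0 < r →
      HasDerivAt (fun r => -Real.log r -
        (1 / 2) * Real.log (1 + ‖mollH (fun t => ψ (s + t)) (deriv A) c r‖ ^ 2)) (Q1 r) r ∧
      HasDerivAt Q1 (Q2 r) r ∧ 0 ≤ Q2 r) := by
    intro s hs c
    have g := good.shift s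
    have hb : ∀ I : ℝ, I ≤ K s → I * (1 / (2 * L)) ≤ 1 / 2 := by
      intro I hI
      rw [mul_one_div, div_le_iff₀ (by positivity)]
      linarith
    exact kernel_main (ε := 1 / 2) (by norm_num) (by norm_num)
      (fun r hr => mollH_hasDerivAt g hB hBm c hr)
      (fun r hr => mollH_hasDerivAt g.profD hB hBm c hr)
      (fun r hr => (mollH_bound g hB c hr).trans (hb _ (hKa s)))
      (fun r hr => (mollH_bound g.profD hB c hr).trans (hb _ (hKb s)))
      (fun r hr => (mollH_bound g.profD.profD hB c hr).trans (hb _ (hKc s)))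
  have hsgn : ∀ a b : ℝ, a ≠ b → ∃ s : ℝ, (s = 1 ∨ s = -1) ∧ 0 < s * (a - b) := by
    intro a b hab
    rcases lt_or_gt_of_ne hab with h | h
    · exact ⟨-1, Or.inr rfl, by linarith⟩
    · exact ⟨1, Or.inl rfl, by linarith⟩
  have habs : ∀ s u : ℝ, (s = 1 ∨ s = -1) → 0 < s * u → |u| = s * u := by
    rintro s u (rfl | rfl) h
    · rw [one_mul] at *; exact abs_of_pos h
    · rw [abs_of_neg (by linarith)]; ring
  refine ⟨fun y x hxy => ?_, fun x y hxy => ?_⟩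
  · obtain ⟨s, hs, hpos⟩ := hsgn x y hxy
    have hss : s * s = 1 := by rcases hs with rfl | rfl <;> norm_num
    have hsL : K s ≤ L := by
      have := hK0 0; have := hK0 1; have := hK0 (-1)
      rcases hs with rfl | rfl <;> linarith
    obtain ⟨Q1, Q2, hQ⟩ := main s hsL y
    refine transfer hss hQ (fun x' hx' => ?_) hpos
    unfold principalKernel
    rw [kernel_eq hd (x' - y) _ hx' (by rw [mul_pow, sq s, hss, one_mul]), habs s _ hs hx']
    have : derivMollified d ψ A (s * (x' - y)) x' =
        mollH (fun t => ψ (s + t)) (deriv A) y (s * (x' - y)) := by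
      unfold derivMollified mollH mollifier
      congr 1
      funext z
      congr 3
      have h0 := hx'.ne'
      rw [div_eq_iff h0, add_mul, div_mul_cancel₀ _ h0, ← mul_assoc, hss]
      ring
    rw [this]
  · obtain ⟨s, hs, hpos⟩ := hsgn y x hxy
    have hss : s * s = 1 := by rcases hs with rfl | rfl <;> norm_num
    have hsL : K 0 ≤ L := by
      have := hK0 0; have := hK0 1; have := hK0 (-1)
      linarith
    obtain ⟨Q1, Q2, hQ⟩ := main 0 hsL x
    refine transfer hss hQ (fun y' hy' => ?_) hpos
    unfold principalKernel
    rw [kernel_eq hd (x - y') _ hy' (by rw [mul_pow, sq s, hss, one_mul]; ring), abs_sub_comm,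
      habs s _ hs hy']
    simp only [zero_add]
    rfl
end

section
/- Let a, b, c, d be four distinct points of ℝ^n, and set M = min{|b-a|, |d-c|}, m = max{|c-a|, |d-b|}, and ε = |(b-a) - (d-c)|. Let f : ℝ^n → ℝ be twice continuously differentiable on an open set containing the closed convex hull Ω̄ of {a,b,c,d}. Then |(f(b) - f(a)) - (f(d) - f(c))| ≤ m · M · sup_{Ω̄}‖∇²f‖ + ε · sup_{Ω̄}‖∇f‖. -/
theorem aux_second_order {E : Type*} [NormedAddCommGroup E] [NormedSpace ℝ E]
    (K O : Set E) (hK : Convex ℝ K) (hO : IsOpen O) (hKO : K ⊆ O) (f : E → ℝ)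
    (hf : ContDiffOn ℝ 2 f O) (G H : ℝ) (hG : ∀ x ∈ K, ‖fderiv ℝ f x‖ ≤ G)
    (hH : ∀ x ∈ K, ‖fderiv ℝ (fderiv ℝ f) x‖ ≤ H)
    (a b c d : E) (ha : a ∈ K) (hb : b ∈ K) (hc : c ∈ K) (hd : d ∈ K) :
    |(f b - f a) - (f d - f c)| ≤
      (max ‖c - a‖ ‖d - b‖) * (min ‖b - a‖ ‖d - c‖) * H + ‖(b - a) - (d - c)‖ * G := by
  have hH0 : 0 ≤ H := (norm_nonneg (fderiv ℝ (fderiv ℝ f) a)).trans (hH a ha)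
  have hdf : ∀ x ∈ K, DifferentiableAt ℝ f x := fun x hx =>
    (hf.contDiffAt (hO.mem_nhds (hKO hx))).differentiableAt (by norm_num)
  have hddf : ∀ x ∈ K, DifferentiableAt ℝ (fderiv ℝ f) x := fun x hx =>
    ((hf.contDiffAt (hO.mem_nhds (hKO hx))).fderiv_right (m := 1) (by norm_num)).differentiableAt
      (by norm_num)
  have hlip : ∀ p ∈ K, ∀ q ∈ K, ‖fderiv ℝ f p - fderiv ℝ f q‖ ≤ H * ‖p - q‖ := fun p hp q hq =>
    hK.norm_image_sub_le_of_norm_fderiv_le hddf hH hq hp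
  have hmem : ∀ x ∈ K, ∀ y ∈ K, ∀ t ∈ Set.Icc (0 : ℝ) 1, x + t • (y - x) ∈ K :=
    fun x hx y hy t ht => hK.add_smul_sub_mem hx hy ht
  have hline : ∀ x ∈ K, ∀ y ∈ K, ∀ t ∈ Set.Icc (0 : ℝ) 1,
      HasDerivAt (fun t : ℝ => f (x + t • (y - x))) (fderiv ℝ f (x + t • (y - x)) (y - x)) t := by
    intro x hx y hy t ht
    have h1 : HasDerivAt (fun t : ℝ => x + t • (y - x)) (y - x) t := by
      simpa using ((hasDerivAt_id t).smul_const (y - x)).const_add x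
    exact (hdf _ (hmem x hx y hy t ht)).hasFDerivAt.comp_hasDerivAt t h1
  have key := norm_image_sub_le_of_norm_deriv_le_segment_01'
    (f := fun t : ℝ => f (a + t • (b - a)) - f (c + t • (d - c)))
    (C := (max ‖c - a‖ ‖d - b‖) * (min ‖b - a‖ ‖d - c‖) * H + ‖(b - a) - (d - c)‖ * G)
    (fun t ht => ((hline a ha b hb t ht).sub (hline c hc d hd t ht)).hasDerivWithinAt) ?_
  · simp only [one_smul, zero_smul, add_zero, add_sub_cancel, Real.norm_eq_abs] at key
    refine le_trans (le_of_eq ?_) key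
    congr 1; ring
  · intro t ht'
    have ht : t ∈ Set.Icc (0 : ℝ) 1 := ⟨ht'.1, ht'.2.le⟩
    have hp := hmem a ha b hb t ht
    have hq := hmem c hc d hd t ht
    have hpq : ‖(a + t • (b - a)) - (c + t • (d - c))‖ ≤ max ‖c - a‖ ‖d - b‖ := by
      have e : (a + t • (b - a)) - (c + t • (d - c)) = -((1 - t) • (c - a) + t • (d - b)) := by
        module
      rw [e, norm_neg]
      have h1 := norm_add_le ((1 - t) • (c - a)) (t • (d - b))
      rw [norm_smul, norm_smul, Real.norm_of_nonneg ht.1,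
        Real.norm_of_nonneg (sub_nonneg.2 ht.2)] at h1
      have h2 := mul_le_mul_of_nonneg_left (le_max_left ‖c - a‖ ‖d - b‖) (sub_nonneg.2 ht.2)
      have h3 := mul_le_mul_of_nonneg_left (le_max_right ‖c - a‖ ‖d - b‖) ht.1
      linarith
    set p := a + t • (b - a)
    set q := c + t • (d - c)
    have hD : ‖fderiv ℝ f p - fderiv ℝ f q‖ ≤ H * max ‖c - a‖ ‖d - b‖ :=
      (hlip p hp q hq).trans (mul_le_mul_of_nonneg_left hpq hH0)
    have hw : ∀ (A : E →L[ℝ] ℝ) (w : E) (r : ℝ), ‖A‖ ≤ r → ‖A w‖ ≤ r * ‖w‖ :=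
      fun A w r h => A.le_of_opNorm_le h w
    rcases le_total ‖b - a‖ ‖d - c‖ with h | h
    · rw [min_eq_left h]
      have e : fderiv ℝ f p (b - a) - fderiv ℝ f q (d - c) =
        (fderiv ℝ f p - fderiv ℝ f q) (b - a) + fderiv ℝ f q ((b - a) - (d - c)) := by
        rw [map_sub (fderiv ℝ f q) (b - a), ContinuousLinearMap.sub_apply]; ring
      rw [e]
      have := norm_add_le ((fderiv ℝ f p - fderiv ℝ f q) (b - a))
        (fderiv ℝ f q ((b - a) - (d - c)))
      have h1 := hw _ (b - a) _ hD
      have h2 := hw _ ((b - a) - (d - c)) _ (hG q hq)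
      linarith
    · rw [min_eq_right h]
      have e : fderiv ℝ f p (b - a) - fderiv ℝ f q (d - c) =
        (fderiv ℝ f p - fderiv ℝ f q) (d - c) + fderiv ℝ f p ((b - a) - (d - c)) := by
        rw [map_sub (fderiv ℝ f p) (b - a), ContinuousLinearMap.sub_apply]; ring
      rw [e]
      have := norm_add_le ((fderiv ℝ f p - fderiv ℝ f q) (d - c))
        (fderiv ℝ f p ((b - a) - (d - c)))
      have h1 := hw _ (d - c) _ hD
      have h2 := hw _ ((b - a) - (d - c)) _ (hG p hp)
      linarith


/-- **Second-order differences under smooth maps.** -/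
theorem second_order_difference (n : ℕ) (a b c d : EuclideanSpace ℝ (Fin n))
    (hab : a ≠ b) (hac : a ≠ c) (had : a ≠ d) (hbc : b ≠ c) (hbd : b ≠ d) (hcd : c ≠ d)
    (f : EuclideanSpace ℝ (Fin n) → ℝ)
    (O : Set (EuclideanSpace ℝ (Fin n))) (hO : IsOpen O)
    (hhull : convexHull ℝ ({a, b, c, d} : Set (EuclideanSpace ℝ (Fin n))) ⊆ O)
    (hf : ContDiffOn ℝ 2 f O) :
    |(f b - f a) - (f d - f c)| ≤
      (max ‖c - a‖ ‖d - b‖) * (min ‖b - a‖ ‖d - c‖) *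
        (⨆ x : (convexHull ℝ ({a, b, c, d} : Set (EuclideanSpace ℝ (Fin n)))),
          ‖fderiv ℝ (fderiv ℝ f) (x : EuclideanSpace ℝ (Fin n))‖) +
      ‖(b - a) - (d - c)‖ *
        (⨆ x : (convexHull ℝ ({a, b, c, d} : Set (EuclideanSpace ℝ (Fin n)))),
          ‖fderiv ℝ f (x : EuclideanSpace ℝ (Fin n))‖) := by
  have hcpt : IsCompact (convexHull ℝ ({a, b, c, d} : Set (EuclideanSpace ℝ (Fin n)))) :=
    Set.Finite.isCompact_convexHull ℝ (Set.toFinite _)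
  have hsub := subset_convexHull ℝ ({a, b, c, d} : Set (EuclideanSpace ℝ (Fin n)))
  have c1 : ContDiffOn ℝ 1 (fderiv ℝ f) O := hf.fderiv_of_isOpen hO (by norm_num)
  have c2 : ContDiffOn ℝ 0 (fderiv ℝ (fderiv ℝ f)) O := c1.fderiv_of_isOpen hO (by norm_num)
  have b1 := hcpt.bddAbove_image (c1.continuousOn.mono hhull).norm
  have k2 : ContinuousOn (fun x => ‖fderiv ℝ (fderiv ℝ f) x‖)
      (convexHull ℝ ({a, b, c, d} : Set (EuclideanSpace ℝ (Fin n)))) :=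
    ContinuousOn.norm (E := EuclideanSpace ℝ (Fin n) →L[ℝ] EuclideanSpace ℝ (Fin n) →L[ℝ] ℝ)
      (c2.continuousOn.mono hhull)
  have b2 := hcpt.bddAbove_image k2
  rw [Set.image_eq_range] at b1 b2
  exact aux_second_order _ O (convex_convexHull ℝ _) hO hhull f hf _ _
    (fun x hx => le_ciSup b1 ⟨x, hx⟩) (fun x hx => le_ciSup b2 ⟨x, hx⟩) a b c d
    (hsub (by simp)) (hsub (by simp)) (hsub (by simp)) (hsub (by simp))
end

section
/- Let α ∈ (0,1] and δ₁, δ₂ > 0, and let R : {(x,y) ∈ ℝ² : x ≠ y} → ℝ be a measurable kernel satisfying |R(x,y)| ≤ min{δ₁, δ₂|x-y|^α} for all x ≠ y, and |R(x,y) - R(x',y)| ≤ |x-x'| · min{δ₁, δ₂|x-y|^α} / |x-y| whenever |x-x'| ≤ |x-y|/2. Let ν be a finite Borel measure on ℝ and set Rν(x) = ∫ R(x,z) dν(z). Then there is a constant C depending only on α, δ₁, δ₂ such that |Rν(x) - Rν(y)| ≤ C |x-y|^α ν(ℝ) for all x, y ∈ ℝ; moreover, for every γ ∈ (0, 1-α]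 there is a constant C' depending only on α, γ, δ₁, δ₂ such that |Rν(x) - Rν(y)| ≤ C' |x-y|^{α+γ} ( ∫|x-z|^{-γ} dν(z) + ∫|y-z|^{-γ} dν(z) ) for all x ≠ y. -/
open MeasureTheory
open scoped ENNReal

/-- The kernel hypotheses of the remainder kernel `R`: size bound
`|R(x,y)| ≤ min{δ₁, δ₂|x-y|^α}` and the smoothness bound
`|R(x,y)-R(x',y)| ≤ |x-x'| min{δ₁, δ₂|x-y|^α}/|x-y|` for `|x-x'| ≤ |x-y|/2`. -/
def IsRemainderKernel (α δ₁ δ₂ : ℝ) (R : ℝ → ℝ → ℝ) : Prop :=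
  Measurable (fun q : ℝ × ℝ => R q.1 q.2) ∧
  (∀ x y : ℝ, x ≠ y → |R x y| ≤ min δ₁ (δ₂ * |x - y| ^ α)) ∧
  (∀ x x' y : ℝ, x ≠ y → |x - x'| ≤ |x - y| / 2 →
    |R x y - R x' y| ≤ |x - x'| * min δ₁ (δ₂ * |x - y| ^ α) / |x - y|)

/-- The potential `Rν(x) = ∫ R(x,z) dν(z)` (the kernel is only defined off the diagonal,
so the integral is taken over `z ≠ x`). -/
noncomputable def remPotential (R : ℝ → ℝ → ℝ) (ν : Measure ℝ) (x : ℝ) : ℝ :=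
  ∫ z, R x z ∂(ν.restrict {x}ᶜ)

/-- The kernel, extended by zero to the diagonal. -/
noncomputable def offDiag (R : ℝ → ℝ → ℝ) (x z : ℝ) : ℝ := Set.indicator {x}ᶜ (R x) z

lemma remPotential_eq (R : ℝ → ℝ → ℝ) (ν : Measure ℝ) (x : ℝ) :
    remPotential R ν x = ∫ z, offDiag R x z ∂ν := by
  unfold remPotential offDiag
  rw [integral_indicator (measurableSet_singleton x).compl]

lemma edist_rpow_eq {x z γ : ℝ} (h : x ≠ z) :
    (edist x z) ^ (-γ) = ENNReal.ofReal (|x - z| ^ (-γ)) := by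
  have hs : 0 < |x - z| := abs_pos.mpr (sub_ne_zero.mpr h)
  rw [edist_dist, Real.dist_eq, ENNReal.ofReal_rpow_of_pos hs]

lemma near_bound {α δ₁ δ₂ γ d : ℝ} (hα0 : 0 < α) (hδ₂ : 0 < δ₂) (hγ : 0 ≤ γ)
    (hγ1 : γ ≤ 1 - α) {R : ℝ → ℝ → ℝ} (hR : IsRemainderKernel α δ₁ δ₂ R) (x z : ℝ)
    (hd : 0 < d) (h : |x - z| ≤ 3 * d) :
    ENNReal.ofReal |offDiag R x z| ≤
      ENNReal.ofReal (3 * δ₂ * d ^ (α + γ)) * (edist x z) ^ (-γ) := by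
  by_cases hxz : x = z
  · subst hxz
    simp [offDiag]
  · have hs : 0 < |x - z| := abs_pos.mpr (sub_ne_zero.mpr hxz)
    rw [edist_rpow_eq hxz, ← ENNReal.ofReal_mul (by positivity)]
    apply ENNReal.ofReal_le_ofReal
    have e : offDiag R x z = R x z := by
      unfold offDiag
      rw [Set.indicator_of_mem]
      simpa using fun h => hxz h.symm
    rw [e]
    set s := |x - z| with hsdef
    have h1 : |R x z| ≤ δ₂ * s ^ α := (hR.2.1 x z hxz).trans (min_le_right _ _)
    have h2 : s ^ α = s ^ (α + γ) * s ^ (-γ) := by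
      rw [← Real.rpow_add hs]; congr 1; ring
    have h3 : s ^ (α + γ) ≤ 3 * d ^ (α + γ) := by
      calc s ^ (α + γ) ≤ (3 * d) ^ (α + γ) :=
            Real.rpow_le_rpow hs.le h (by linarith)
        _ = 3 ^ (α + γ) * d ^ (α + γ) := Real.mul_rpow (by norm_num) hd.le
        _ ≤ 3 * d ^ (α + γ) := by
            gcongr
            calc (3 : ℝ) ^ (α + γ) ≤ 3 ^ (1 : ℝ) :=
                  Real.rpow_le_rpow_of_exponent_le (by norm_num) (by linarith)
              _ = 3 := Real.rpow_one _
    calc |R x z| ≤ δ₂ * (s ^ (α + γ) * s ^ (-γ)) := by rw [← h2]; exact h1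
      _ ≤ δ₂ * ((3 * d ^ (α + γ)) * s ^ (-γ)) := by gcongr
      _ = 3 * δ₂ * d ^ (α + γ) * s ^ (-γ) := by ring

lemma far_bound {α δ₁ δ₂ γ : ℝ} (hδ₂ : 0 < δ₂)
    (hγ1 : γ ≤ 1 - α) {R : ℝ → ℝ → ℝ} (hR : IsRemainderKernel α δ₁ δ₂ R) (x y z : ℝ)
    (hd : 0 < |x - y|) (h : |x - y| ≤ |x - z| / 2) :
    ENNReal.ofReal |offDiag R x z - offDiag R y z| ≤
      ENNReal.ofReal (3 * δ₂ * |x - y| ^ (α + γ)) * (edist x z) ^ (-γ) := by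
  have hs : 0 < |x - z| := by linarith
  have hxz : x ≠ z := sub_ne_zero.mp (abs_pos.mp hs)
  have hyz : y ≠ z := by
    rintro rfl
    linarith
  have e : ∀ w, w ≠ z → offDiag R w z = R w z := by
    intro w hw
    unfold offDiag
    rw [Set.indicator_of_mem]
    simpa using fun h => hw h.symm
  rw [edist_rpow_eq hxz, ← ENNReal.ofReal_mul (by positivity), e x hxz, e y hyz]
  apply ENNReal.ofReal_le_ofReal
  have h1 := hR.2.2 x y z hxz h
  set s := |x - z| with hsdef
  set d := |x - y| with hddef
  have h2 : d * min δ₁ (δ₂ * s ^ α) / s ≤ d * (δ₂ * s ^ α) / s := by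
    gcongr
    exact min_le_right _ _
  have h3 : s ^ α / s = s ^ (-γ) * s ^ (-(1 - α - γ)) := by
    rw [← Real.rpow_add hs, ← Real.rpow_sub_one hs.ne']
    congr 1; ring
  have h4 : s ^ (-(1 - α - γ)) ≤ d ^ (-(1 - α - γ)) :=
    Real.rpow_le_rpow_of_nonpos hd (by linarith) (by linarith)
  have h5 : d * d ^ (-(1 - α - γ)) = d ^ (α + γ) := by
    nth_rewrite 1 [← Real.rpow_one d]
    rw [← Real.rpow_add hd]; congr 1; ring
  calc |R x z - R y z| ≤ d * (δ₂ * s ^ α) / s := h1.trans h2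
    _ = δ₂ * d * (s ^ α / s) := by ring
    _ = δ₂ * d * (s ^ (-γ) * s ^ (-(1 - α - γ))) := by rw [h3]
    _ ≤ δ₂ * d * (s ^ (-γ) * d ^ (-(1 - α - γ))) := by gcongr
    _ = δ₂ * (d * d ^ (-(1 - α - γ))) * s ^ (-γ) := by ring
    _ = 1 * δ₂ * d ^ (α + γ) * s ^ (-γ) := by rw [h5, one_mul]
    _ ≤ 3 * δ₂ * d ^ (α + γ) * s ^ (-γ) := by gcongr; norm_num

lemma pointwise_bound {α δ₁ δ₂ γ : ℝ} (hα0 : 0 < α) (hδ₂ : 0 < δ₂) (hγ : 0 ≤ γ)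
    (hγ1 : γ ≤ 1 - α) {R : ℝ → ℝ → ℝ} (hR : IsRemainderKernel α δ₁ δ₂ R) (x y z : ℝ)
    (hxy : x ≠ y) :
    ENNReal.ofReal |offDiag R x z - offDiag R y z| ≤
      ENNReal.ofReal (3 * δ₂ * |x - y| ^ (α + γ)) *
        ((edist x z) ^ (-γ) + (edist y z) ^ (-γ)) := by
  have hd : 0 < |x - y| := abs_pos.mpr (sub_ne_zero.mpr hxy)
  rw [mul_add]
  rcases le_or_gt (|x - y|) (|x - z| / 2) with h | h
  · exact (far_bound hδ₂ hγ1 hR x y z hd h).trans le_self_add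
  · have hy : |y - z| ≤ 3 * |x - y| := by
      have := abs_sub_le y x z
      rw [abs_sub_comm y x] at this
      linarith
    calc ENNReal.ofReal |offDiag R x z - offDiag R y z|
        ≤ ENNReal.ofReal (|offDiag R x z| + |offDiag R y z|) :=
          ENNReal.ofReal_le_ofReal (abs_sub _ _)
      _ = ENNReal.ofReal |offDiag R x z| + ENNReal.ofReal |offDiag R y z| :=
          ENNReal.ofReal_add (abs_nonneg _) (abs_nonneg _)
      _ ≤ _ := add_le_add (near_bound hα0 hδ₂ hγ hγ1 hR x z hd (by linarith))
          (near_bound hα0 hδ₂ hγ hγ1 hR y z hd hy)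

lemma integrable_offDiag {α δ₁ δ₂ : ℝ} (hδ₁ : 0 < δ₁) {R : ℝ → ℝ → ℝ}
    (hR : IsRemainderKernel α δ₁ δ₂ R) (ν : Measure ℝ) [IsFiniteMeasure ν] (x : ℝ) :
    Integrable (offDiag R x) ν := by
  have hm : Measurable (R x) := hR.1.comp measurable_prodMk_left
  have hm' : Measurable (offDiag R x) := hm.indicator (measurableSet_singleton x).compl
  refine Integrable.of_bound hm'.aestronglyMeasurable δ₁ (Filter.Eventually.of_forall fun z => ?_)
  unfold offDiag
  by_cases hz : x = z
  · subst hz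
    simpa using hδ₁.le
  · rw [Set.indicator_of_mem (by simpa using fun h => hz h.symm), Real.norm_eq_abs]
    exact (hR.2.1 x z hz).trans (min_le_left _ _)

lemma main_bound {α δ₁ δ₂ γ : ℝ} (hα0 : 0 < α) (hδ₁ : 0 < δ₁) (hδ₂ : 0 < δ₂) (hγ : 0 ≤ γ)
    (hγ1 : γ ≤ 1 - α) {R : ℝ → ℝ → ℝ} (hR : IsRemainderKernel α δ₁ δ₂ R)
    (ν : Measure ℝ) [IsFiniteMeasure ν] (x y : ℝ) (hxy : x ≠ y) :
    ENNReal.ofReal |remPotential R ν x - remPotential R ν y| ≤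
      ENNReal.ofReal (3 * δ₂ * |x - y| ^ (α + γ)) *
        ((∫⁻ z, (edist x z) ^ (-γ) ∂ν) + ∫⁻ z, (edist y z) ^ (-γ) ∂ν) := by
  rw [remPotential_eq, remPotential_eq,
    ← integral_sub (integrable_offDiag hδ₁ hR ν x) (integrable_offDiag hδ₁ hR ν y),
    ← Real.norm_eq_abs, ofReal_norm_eq_enorm]
  have hm : Measurable fun z : ℝ => (edist x z) ^ (-γ) := by fun_prop
  rw [← lintegral_add_left hm, ← lintegral_const_mul' _ _ ENNReal.ofReal_ne_top]
  refine (enorm_integral_le_lintegral_enorm _).trans (lintegral_mono fun z => ?_)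
  have := pointwise_bound hα0 hδ₂ hγ hγ1 hR x y z hxy
  rwa [← Real.norm_eq_abs, ofReal_norm_eq_enorm] at this

/-- **Hölder continuity of remainder potentials.** -/
theorem remainder_potential_holder (α δ₁ δ₂ : ℝ) (hα0 : 0 < α) (hα1 : α ≤ 1)
    (hδ₁ : 0 < δ₁) (hδ₂ : 0 < δ₂) :
    (∃ C : ℝ, 0 < C ∧
      ∀ R : ℝ → ℝ → ℝ, IsRemainderKernel α δ₁ δ₂ R →
        ∀ ν : Measure ℝ, IsFiniteMeasure ν →
          ∀ x y : ℝ,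
            |remPotential R ν x - remPotential R ν y| ≤
              C * |x - y| ^ α * (ν Set.univ).toReal) ∧
    (∀ γ : ℝ, 0 < γ → γ ≤ 1 - α →
      ∃ C' : ℝ, 0 < C' ∧
        ∀ R : ℝ → ℝ → ℝ, IsRemainderKernel α δ₁ δ₂ R →
          ∀ ν : Measure ℝ, IsFiniteMeasure ν →
            ∀ x y : ℝ, x ≠ y →
              ENNReal.ofReal |remPotential R ν x - remPotential R ν y| ≤
                ENNReal.ofReal (C' * |x - y| ^ (α + γ)) *
                  ((∫⁻ z, (edist x z) ^ (-γ) ∂ν) + ∫⁻ z, (edist y z) ^ (-γ) ∂ν)) := by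
  constructor
  · refine ⟨6 * δ₂, by positivity, ?_⟩
    intro R hR ν hν x y
    by_cases hxy : x = y
    · subst hxy
      simp [Real.zero_rpow hα0.ne']
    · have h := main_bound hα0 hδ₁ hδ₂ le_rfl (by linarith) hR ν x y hxy
      simp only [neg_zero, ENNReal.rpow_zero, lintegral_const, one_mul, add_zero] at h
      rw [← ENNReal.ofReal_toReal (measure_ne_top ν Set.univ),
        ← ENNReal.ofReal_add ENNReal.toReal_nonneg ENNReal.toReal_nonneg,
        ← ENNReal.ofReal_mul (by positivity),
        ENNReal.ofReal_le_ofReal_iff (by positivity)] at h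
      linarith
  · intro γ hγ hγ1
    refine ⟨3 * δ₂, by positivity, ?_⟩
    intro R hR ν hν x y hxy
    exact main_bound hα0 hδ₁ hδ₂ hγ.le hγ1 hR ν x y hxy
end

section
/- Let I = [a,b] ⊂ ℝ with a < b, let α ∈ (0,1] and C ≥ 0, and let U, P, R : I → ℝ be functions such that U = P + R on I, P is convex on I, and R is α-Hölder continuous with constant C, i.e. |R(x) - R(y)| ≤ C|x-y|^α for x,y ∈ I. Then for every x ∈ I: U(x) - U(a) ≤ (x-a)·|U(b)-U(a)|/(b-a) + 2C(x-a)^α, and U(x) - U(b) ≤ (b-x)·|U(b)-U(a)|/(b-a) + 2C(b-x)^α. -/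
theorem hfc_aux (θ L α : ℝ) (h0 : 0 ≤ θ) (h1 : θ ≤ 1) (hL : 0 ≤ L) (hα0 : 0 < α) (hα1 : α ≤ 1) :
    θ * L ^ α ≤ (θ * L) ^ α := by
  rw [Real.mul_rpow h0 hL]
  exact mul_le_mul_of_nonneg_right (Real.self_le_rpow_of_le_one h0 h1 hα1) (Real.rpow_nonneg hL α)

/-- **Hölder estimates from convexity.** If `U = P + R` on `I = [a,b]` with `P` convex and
`R` `α`-Hölder with constant `C`, then the stated one-sided estimates hold. -/
theorem holder_from_convexity (a b : ℝ) (hab : a < b) (α C : ℝ)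
    (hα0 : 0 < α) (hα1 : α ≤ 1) (hC : 0 ≤ C)
    (U P R : ℝ → ℝ)
    (hUPR : ∀ x ∈ Set.Icc a b, U x = P x + R x)
    (hP : ConvexOn ℝ (Set.Icc a b) P)
    (hR : ∀ x ∈ Set.Icc a b, ∀ y ∈ Set.Icc a b, |R x - R y| ≤ C * |x - y| ^ α) :
    ∀ x ∈ Set.Icc a b,
      U x - U a ≤ (x - a) * |U b - U a| / (b - a) + 2 * C * (x - a) ^ α ∧
      U x - U b ≤ (b - x) * |U b - U a| / (b - a) + 2 * C * (b - x) ^ α := by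
  intro x hx
  have hL : 0 < b - a := sub_pos.mpr hab
  have ha : a ∈ Set.Icc a b := ⟨le_rfl, hab.le⟩
  have hb : b ∈ Set.Icc a b := ⟨hab.le, le_rfl⟩
  obtain ⟨θ, hθ⟩ : ∃ θ, θ = (x - a) / (b - a) := ⟨_, rfl⟩
  have hxa : x - a = θ * (b - a) := by rw [hθ]; field_simp
  have hbx : b - x = (1 - θ) * (b - a) := by linarith
  have h0 : 0 ≤ θ := by rw [hθ]; exact div_nonneg (sub_nonneg.mpr hx.1) hL.le
  have h1 : θ ≤ 1 := by rw [hθ, div_le_one hL]; linarith [hx.2]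
  have hPx : P x ≤ (1 - θ) * P a + θ * P b := by
    have h := hP.2 ha hb (sub_nonneg.mpr h1) h0 (by ring)
    simp only [smul_eq_mul] at h
    have e : (1 - θ) * a + θ * b = x := by linarith
    rwa [e] at h
  have k1 := hfc_aux θ (b - a) α h0 h1 hL.le hα0 hα1
  have k2 := hfc_aux (1 - θ) (b - a) α (by linarith) (by linarith) hL.le hα0 hα1
  have r := abs_le.mp (hR b hb a ha)
  have ra := (abs_le.mp (hR x hx a ha)).2
  have rb := (abs_le.mp (hR x hx b hb)).2
  rw [abs_of_pos hL] at r
  rw [abs_of_nonneg (sub_nonneg.mpr hx.1)] at ra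
  rw [abs_sub_comm, abs_of_nonneg (sub_nonneg.mpr hx.2)] at rb
  rw [← hxa] at k1
  rw [← hbx] at k2
  have e1 : (x - a) * |U b - U a| / (b - a) = θ * |U b - U a| := by rw [hxa]; field_simp
  have e2 : (b - x) * |U b - U a| / (b - a) = (1 - θ) * |U b - U a| := by rw [hbx]; field_simp
  rw [e1, e2]
  have m1 := mul_le_mul_of_nonneg_left k1 hC
  have m2 := mul_le_mul_of_nonneg_left k2 hC
  have u1 := mul_le_mul_of_nonneg_left (le_abs_self (U b - U a)) h0
  have u2 := mul_le_mul_of_nonneg_left (neg_abs_le (U b - U a)) (sub_nonneg.mpr h1)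
  have r1 := mul_le_mul_of_nonneg_left r.1 h0
  have r2 := mul_le_mul_of_nonneg_left r.2 (sub_nonneg.mpr h1)
  have ea := hUPR a ha
  have eb := hUPR b hb
  have ex := hUPR x hx
  have pa : P a = U a - R a := by linarith
  have pb : P b = U b - R b := by linarith
  rw [pa, pb] at hPx
  constructor
  · linarith
  · linarith
end

section
/- Let f : ℝ → ℂ be a Schwartz function. Then the iterated integral ∫_ℝ log|x| · ( ∫_ℝ e^{-2πixξ} |ξ| f(ξ) dξ ) dx converges absolutely and equals -(1/2) ∫_ℝ f(ξ) dξ. -/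
open MeasureTheory

lemma lk_kernel_bound_integrable {c : ℝ} (hc : 0 < c) :
    IntegrableOn (fun r : ℝ => r⁻¹ * (r ^ 2)⁻¹ * Real.exp (-(c / r ^ 2))) (Set.Ioi 0) := by
  have h1 : IntegrableOn (fun s : ℝ => Real.exp (-c * s)) (Set.Ioi 0) :=
    integrableOn_exp_mul_Ioi (by linarith) 0
  have h2 := (integrableOn_Ioi_comp_rpow_iff (fun s : ℝ => Real.exp (-c * s))
    (p := -2) (by norm_num)).2 h1
  refine IntegrableOn.congr_fun (h2.const_mul (1 / 2)) ?_ measurableSet_Ioi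
  intro r hr
  have hr' : 0 < r := hr
  have e1 : r ^ (-2 : ℝ) = (r ^ 2)⁻¹ := by
    rw [Real.rpow_neg hr'.le]; norm_num
  have e2 : r ^ (-2 - 1 : ℝ) = r⁻¹ * (r ^ 2)⁻¹ := by
    rw [Real.rpow_sub_one hr'.ne', e1]; field_simp
  simp only [e1, e2, smul_eq_mul]
  rw [abs_of_neg (by norm_num)]
  rw [show -c * (r ^ 2)⁻¹ = -(c / r ^ 2) by ring]
  ring

lemma lk_exp_diff (u v m : ℝ) (hu : m ≤ u) (hv : m ≤ v) :
    |Real.exp (-u) - Real.exp (-v)| ≤ |u - v| * Real.exp (-m) := by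
  wlog h : u ≤ v generalizing u v
  · rw [abs_sub_comm, abs_sub_comm u v]; exact this v u hv hu (le_of_not_ge h)
  have h1 : Real.exp (-v) = Real.exp (-u) * Real.exp (u - v) := by
    rw [← Real.exp_add]; congr 1; ring
  have h2 := Real.add_one_le_exp (u - v)
  have h3 : Real.exp (-v) ≤ Real.exp (-u) := Real.exp_le_exp.2 (by linarith)
  have h4 : Real.exp (-u) ≤ Real.exp (-m) := Real.exp_le_exp.2 (by linarith)
  rw [abs_of_nonneg (by linarith), abs_of_nonpos (by linarith), h1]
  have := Real.exp_pos (-u)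
  nlinarith

/-- the kernel -/
noncomputable def lkK (r x : ℝ) : ℝ :=
  r⁻¹ * (Real.exp (-(Real.pi / r ^ 2)) - Real.exp (-(Real.pi * x ^ 2 / r ^ 2)))

lemma lkK_integrable {x : ℝ} (hx : x ≠ 0) : IntegrableOn (fun r => lkK r x) (Set.Ioi 0) := by
  have hx2 : 0 < x ^ 2 := by positivity
  have hc : 0 < Real.pi * min 1 (x ^ 2) := by have := Real.pi_pos; positivity
  refine Integrable.mono' ((lk_kernel_bound_integrable hc).const_mul (Real.pi * |1 - x ^ 2|)) ?_ ?_
  · unfold lkK; exact (by fun_prop : Measurable _).aestronglyMeasurable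
  · refine (ae_restrict_iff' measurableSet_Ioi).2 (Filter.Eventually.of_forall fun r hr => ?_)
    have hr' : 0 < r := hr
    have hr2 : 0 < r ^ 2 := by positivity
    have hpi := Real.pi_pos
    have := lk_exp_diff (Real.pi / r ^ 2) (Real.pi * x ^ 2 / r ^ 2) (Real.pi * min 1 (x ^ 2) / r ^ 2)
      (by gcongr; nlinarith [min_le_left 1 (x ^ 2)]) (by gcongr; exact min_le_right _ _)
    rw [show Real.pi / r ^ 2 - Real.pi * x ^ 2 / r ^ 2 = Real.pi * (1 - x ^ 2) * (r ^ 2)⁻¹ by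
      ring, abs_mul, abs_mul, abs_of_pos hpi, abs_of_pos (inv_pos.2 hr2)] at this
    unfold lkK
    rw [Real.norm_eq_abs, abs_mul, abs_of_pos (inv_pos.2 hr')]
    calc _ ≤ r⁻¹ * _ := mul_le_mul_of_nonneg_left this (inv_pos.2 hr').le
      _ = _ := by ring

lemma lkK_integral {x : ℝ} (hx : x ≠ 0) : ∫ r in Set.Ioi 0, lkK r x = Real.log |x| := by
  have hxa : 0 < |x| := abs_pos.2 hx
  have hpi := Real.pi_pos
  have key : ∀ r : ℝ, lkK r x = r⁻¹ • ((fun s : ℝ => Real.exp (-(Real.pi / s ^ 2))) (1 * r)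
      - (fun s : ℝ => Real.exp (-(Real.pi / s ^ 2))) (|x|⁻¹ * r)) := by
    intro r
    simp only [lkK, smul_eq_mul, one_mul, mul_pow, inv_pow, sq_abs]
    congr 4
    rw [div_mul_eq_div_div, div_inv_eq_mul]
  have hint := lkK_integrable hx
  simp only [key] at hint ⊢
  have t1 : Filter.Tendsto (fun s : ℝ => Real.exp (-(Real.pi / s ^ 2))) (nhdsWithin 0 (Set.Ioi 0))
      (nhds 0) := by
    refine Real.tendsto_exp_neg_atTop_nhds_zero.comp ?_
    have h : Filter.Tendsto (fun s : ℝ => s⁻¹ ^ 2) (nhdsWithin 0 (Set.Ioi 0)) Filter.atTop :=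
      (Filter.tendsto_pow_atTop (by norm_num)).comp tendsto_inv_nhdsGT_zero
    refine (h.const_mul_atTop hpi).congr fun s => by rw [inv_pow]; rfl
  have t2 : Filter.Tendsto (fun s : ℝ => Real.exp (-(Real.pi / s ^ 2))) Filter.atTop
      (nhds 1) := by
    have h : Filter.Tendsto (fun s : ℝ => -(Real.pi / s ^ 2)) Filter.atTop (nhds 0) := by
      rw [← neg_zero]
      exact (Filter.Tendsto.const_div_atTop (Filter.tendsto_pow_atTop (by norm_num)) _).neg
    simpa [Function.comp_def] using (Real.continuous_exp.tendsto 0).comp h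
  have hl : LocallyIntegrableOn (fun s : ℝ => Real.exp (-(Real.pi / s ^ 2))) (Set.Ioi 0) := by
    refine ContinuousOn.locallyIntegrableOn ?_ measurableSet_Ioi
    intro s hs
    have : s ^ 2 ≠ 0 := pow_ne_zero _ (ne_of_gt hs)
    exact ContinuousAt.continuousWithinAt (by fun_prop (disch := assumption))
  rw [Frullani.integral_Ioi_eq hl one_pos (inv_pos.2 hxa) t1 t2 hint]
  simp

lemma lkK_integral_abs {x : ℝ} (hx : x ≠ 0) :
    ∫ r in Set.Ioi 0, |lkK r x| = |(Real.log |x|)| := by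
  have hpi := Real.pi_pos
  rw [← lkK_integral hx]
  rcases le_total 1 (x ^ 2) with h | h
  · have : ∀ r ∈ Set.Ioi (0:ℝ), 0 ≤ lkK r x := by
      intro r (hr : 0 < r)
      unfold lkK
      refine mul_nonneg (inv_pos.2 hr).le (sub_nonneg.2 (Real.exp_le_exp.2 (neg_le_neg ?_)))
      gcongr; nlinarith
    rw [abs_of_nonneg (setIntegral_nonneg measurableSet_Ioi this)]
    exact setIntegral_congr_fun measurableSet_Ioi fun r hr => abs_of_nonneg (this r hr)
  · have : ∀ r ∈ Set.Ioi (0:ℝ), lkK r x ≤ 0 := by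
      intro r (hr : 0 < r)
      unfold lkK
      refine mul_nonpos_of_nonneg_of_nonpos (inv_pos.2 hr).le
        (sub_nonpos.2 (Real.exp_le_exp.2 (neg_le_neg ?_)))
      gcongr; nlinarith
    rw [abs_of_nonpos (setIntegral_nonpos measurableSet_Ioi this), ← integral_neg]
    exact setIntegral_congr_fun measurableSet_Ioi fun r hr => abs_of_nonpos (this r hr)

lemma lk_exp_norm (x ξ : ℝ) :
    ‖Complex.exp (-(2 * (Real.pi : ℂ) * Complex.I * (x : ℂ) * (ξ : ℂ)))‖ = 1 := by
  rw [show -(2 * (Real.pi : ℂ) * Complex.I * (x : ℂ) * (ξ : ℂ)) =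
    ((-(2 * Real.pi * x * ξ) : ℝ) : ℂ) * Complex.I by push_cast; ring]
  exact Complex.norm_exp_ofReal_mul_I _

lemma lk_exp_integrable (u : SchwartzMap ℝ ℂ) (x : ℝ) :
    Integrable (fun ξ : ℝ => Complex.exp (-(2 * (Real.pi : ℂ) * Complex.I * (x : ℂ) * (ξ : ℂ))) * u ξ) := by
  refine u.integrable.mono (by
    have := u.continuous
    exact (by fun_prop : Continuous _).aestronglyMeasurable) ?_
  exact Filter.Eventually.of_forall fun ξ => by rw [norm_mul, lk_exp_norm, one_mul]

lemma lk_half (u : SchwartzMap ℝ ℂ) (hu : u 0 = 0) : ∃ C : ℝ, 0 ≤ C ∧ ∀ x : ℝ,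
    x ^ 2 * ‖∫ ξ in Set.Ioi (0:ℝ), Complex.exp (-(2 * (Real.pi : ℂ) * Complex.I * (x : ℂ) * (ξ : ℂ))) * u ξ‖ ≤ C ∧
    x ^ 2 * ‖∫ ξ in Set.Iic (0:ℝ), Complex.exp (-(2 * (Real.pi : ℂ) * Complex.I * (x : ℂ) * (ξ : ℂ))) * u ξ‖ ≤ C := by
  let u1 := SchwartzMap.derivCLM ℂ ℂ u
  let u2 := SchwartzMap.derivCLM ℂ ℂ u1
  have hpi : 1 ≤ Real.pi := by linarith [Real.pi_gt_three]
  refine ⟨‖u1 0‖ + ∫ ξ, ‖u2 ξ‖, by positivity, fun x => ?_⟩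
  set c : ℂ := 2 * (Real.pi : ℂ) * Complex.I * (x : ℂ) with hc
  have hcn : x ^ 2 ≤ ‖c ^ 2‖ := by
    rw [norm_pow, hc]
    simp only [norm_mul, Complex.norm_I, Complex.norm_real, Real.norm_eq_abs, mul_one,
      Complex.norm_ofNat]
    rw [← sq_abs x, abs_of_pos Real.pi_pos]
    gcongr
    nlinarith [abs_nonneg x]
  let E : ℝ → ℂ := fun ξ => Complex.exp (-(c * ξ))
  have hE : ∀ ξ, ‖E ξ‖ = 1 := fun ξ => lk_exp_norm x ξ
  let F : ℝ → ℂ := fun ξ => E ξ * (c * u ξ + u1 ξ)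
  have hF0 : F 0 = u1 0 := by simp [F, E, hu]
  have hder : ∀ ξ, HasDerivAt F (E ξ * u2 ξ - c ^ 2 * (E ξ * u ξ)) ξ := by
    intro ξ
    have e1 : HasDerivAt E (E ξ * (-(c * 1))) ξ :=
      HasDerivAt.cexp (((hasDerivAt_id ξ).ofReal_comp.const_mul c).neg)
    have d1 : HasDerivAt u (u1 ξ) ξ := u.hasDerivAt ξ
    have d2 : HasDerivAt u1 (u2 ξ) ξ := u1.hasDerivAt ξ
    convert! e1.mul ((d1.const_mul c).add d2) using 1
    simp only [Pi.add_apply]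
    ring
  have i0 : Integrable (fun ξ => E ξ * u ξ) := lk_exp_integrable u x
  have i2 : Integrable (fun ξ => E ξ * u2 ξ) := lk_exp_integrable u2 x
  have hlim : Filter.Tendsto F (Filter.cocompact ℝ) (nhds 0) := by
    have h : Filter.Tendsto (fun ξ => c * u ξ + u1 ξ) (Filter.cocompact ℝ) (nhds 0) := by
      simpa using (u.tendsto_cocompact.const_mul c).add u1.tendsto_cocompact
    rw [tendsto_zero_iff_norm_tendsto_zero] at h ⊢
    refine h.congr fun ξ => ?_
    simp only [F, norm_mul, hE, one_mul]
  have hbd : ∀ s : Set ℝ, ‖∫ ξ in s, E ξ * u2 ξ‖ ≤ ∫ ξ, ‖u2 ξ‖ := by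
    intro s
    refine (norm_integral_le_integral_norm _).trans ?_
    simp only [norm_mul, hE, one_mul]
    exact setIntegral_le_integral u2.integrable.norm (Filter.Eventually.of_forall fun _ => norm_nonneg _)
  have fin : ∀ A B : ℂ, c ^ 2 * A = B → x ^ 2 * ‖A‖ ≤ ‖B‖ := by
    intro A B h
    rw [← h, norm_mul]
    gcongr
  constructor
  · have h := integral_Ioi_of_hasDerivAt_of_tendsto' (a := 0) (fun ξ _ => hder ξ)
      (i2.sub (i0.const_mul (c ^ 2))).integrableOn (hlim.mono_left atTop_le_cocompact)
    rw [integral_sub i2.integrableOn (i0.const_mul (c ^ 2)).integrableOn, integral_const_mul, hF0] at h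
    refine (fin _ (u1 0 + ∫ ξ in Set.Ioi 0, E ξ * u2 ξ) ?_).trans ((norm_add_le _ _).trans ?_)
    · linear_combination -h
    · gcongr; exact hbd _
  · have h := integral_Iic_of_hasDerivAt_of_tendsto' (a := 0) (fun ξ _ => hder ξ)
      (i2.sub (i0.const_mul (c ^ 2))).integrableOn (hlim.mono_left atBot_le_cocompact)
    rw [integral_sub i2.integrableOn (i0.const_mul (c ^ 2)).integrableOn, integral_const_mul, hF0] at h
    refine (fin _ (-u1 0 + ∫ ξ in Set.Iic 0, E ξ * u2 ξ) ?_).trans ((norm_add_le _ _).trans ?_)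
    · linear_combination -h
    · rw [norm_neg]; gcongr; exact hbd _

lemma lk_g_integrable (f : SchwartzMap ℝ ℂ) : Integrable (fun ξ : ℝ => ((|ξ| : ℝ) : ℂ) * f ξ) := by
  refine (f.integrable_pow_mul volume 1).mono (by
    have := f.continuous
    exact (by fun_prop : Continuous _).aestronglyMeasurable) ?_
  exact Filter.Eventually.of_forall fun ξ => by simp

lemma lk_decay (f : SchwartzMap ℝ ℂ) : ∃ C : ℝ, 0 ≤ C ∧ ∀ x : ℝ,
    ‖∫ ξ : ℝ, Complex.exp (-(2 * (Real.pi : ℂ) * Complex.I * (x : ℂ) * (ξ : ℂ))) *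
          ((|ξ| : ℝ) : ℂ) * f ξ‖ ≤ C * (1 + x ^ 2)⁻¹ := by
  have hid : (fun ξ : ℝ => (ξ : ℂ)).HasTemperateGrowth := by
    exact Complex.ofRealCLM.hasTemperateGrowth
  let u := SchwartzMap.smulLeftCLM ℂ (fun ξ : ℝ => (ξ : ℂ)) f
  have hu : ∀ ξ, u ξ = (ξ : ℂ) * f ξ := fun ξ => by
    simp only [u, SchwartzMap.smulLeftCLM_apply_apply hid, smul_eq_mul]
  obtain ⟨C, hC, h⟩ := lk_half u (by simp [hu])
  have hg := lk_g_integrable f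
  refine ⟨(∫ ξ, ‖((|ξ| : ℝ) : ℂ) * f ξ‖) + 2 * C, by positivity, fun x => ?_⟩
  obtain ⟨h1, h2⟩ := h x
  set G := ∫ ξ : ℝ, Complex.exp (-(2 * (Real.pi : ℂ) * Complex.I * (x : ℂ) * (ξ : ℂ))) *
          ((|ξ| : ℝ) : ℂ) * f ξ with hG
  have b0 : ‖G‖ ≤ ∫ ξ, ‖((|ξ| : ℝ) : ℂ) * f ξ‖ := by
    refine (norm_integral_le_integral_norm _).trans (le_of_eq ?_)
    congr 1; ext ξ
    rw [mul_assoc, norm_mul, lk_exp_norm, one_mul]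
  have hint : Integrable (fun ξ : ℝ => Complex.exp (-(2 * (Real.pi : ℂ) * Complex.I * (x : ℂ) * (ξ : ℂ))) *
          ((|ξ| : ℝ) : ℂ) * f ξ) := by
    refine hg.mono (by
      have := f.continuous
      exact (by fun_prop : Continuous _).aestronglyMeasurable) ?_
    exact Filter.Eventually.of_forall fun ξ => by rw [mul_assoc, norm_mul, lk_exp_norm, one_mul]
  have hsplit : G = -(∫ ξ in Set.Iic (0:ℝ), Complex.exp (-(2 * (Real.pi : ℂ) * Complex.I * (x : ℂ) * (ξ : ℂ))) * u ξ)
      + ∫ ξ in Set.Ioi (0:ℝ), Complex.exp (-(2 * (Real.pi : ℂ) * Complex.I * (x : ℂ) * (ξ : ℂ))) * u ξ := by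
    rw [hG, ← intervalIntegral.integral_Iic_add_Ioi (b := 0) hint.integrableOn hint.integrableOn, ← integral_neg]
    congr 1
    · refine setIntegral_congr_fun measurableSet_Iic fun ξ hξ => ?_
      simp only [hu, abs_of_nonpos (Set.mem_Iic.1 hξ)]
      push_cast; ring
    · refine setIntegral_congr_fun measurableSet_Ioi fun ξ hξ => ?_
      simp only [hu, abs_of_pos (Set.mem_Ioi.1 hξ)]
      ring
  have b1 : x ^ 2 * ‖G‖ ≤ 2 * C := by
    have : ‖G‖ ≤ _ := (congrArg norm hsplit).le.trans (norm_add_le _ _)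
    rw [norm_neg] at this
    nlinarith [mul_le_mul_of_nonneg_left this (sq_nonneg x)]
  rw [← div_eq_mul_inv, le_div_iff₀ (by positivity)]
  linarith

lemma lk_log_integrable : Integrable (fun x : ℝ => |(Real.log |x|)| * (1 + x ^ 2)⁻¹) := by
  have hIoi : IntegrableOn (fun x : ℝ => |(Real.log |x|)| * (1 + x ^ 2)⁻¹) (Set.Ioi 0) := by
    have hm : Measurable (fun x : ℝ => |(Real.log |x|)| * (1 + x ^ 2)⁻¹) := by
      have : Measurable (fun x : ℝ => |(Real.log |x|)|) := by
        simp only [Real.log_abs]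
        exact Real.measurable_log.abs
      fun_prop
    rw [← Set.Ioc_union_Ioi_eq_Ioi (zero_le_one : (0:ℝ) ≤ 1)]
    refine IntegrableOn.union ?_ ?_
    · have h : IntegrableOn Real.log (Set.Ioc 0 1) :=
        (intervalIntegrable_iff_integrableOn_Ioc_of_le zero_le_one).1
          intervalIntegral.intervalIntegrable_log'
      refine Integrable.mono h hm.aestronglyMeasurable (Filter.Eventually.of_forall fun x => ?_)
      rw [norm_mul, Real.log_abs, Real.norm_eq_abs, abs_abs, Real.norm_eq_abs, Real.norm_eq_abs]
      refine mul_le_of_le_one_right (abs_nonneg _) ?_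
      rw [abs_of_pos (by positivity)]
      exact inv_le_one_of_one_le₀ (by nlinarith [sq_nonneg x])
    · have h := (integrableOn_Ioi_rpow_of_lt (a := -3/2) (by norm_num) one_pos).const_mul 2
      refine Integrable.mono' h hm.aestronglyMeasurable ?_
      refine (ae_restrict_iff' measurableSet_Ioi).2 (Filter.Eventually.of_forall fun x hx => ?_)
      have hx1 : 1 < x := hx
      have hx0 : 0 < x := by linarith
      have hl := Real.log_le_rpow_div hx0.le (ε := 1/2) (by norm_num)
      have hl0 := Real.log_pos hx1
      rw [Real.log_abs, Real.norm_eq_abs, abs_mul, abs_abs, abs_of_pos hl0, abs_of_pos (by positivity)]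
      have e : x ^ (-3/2 : ℝ) = x ^ (1/2 : ℝ) * (x ^ 2)⁻¹ := by
        rw [← Real.rpow_natCast x 2, ← Real.rpow_neg hx0.le, ← Real.rpow_add hx0]; norm_num
      rw [e]
      calc _ ≤ (x ^ (1/2:ℝ) / (1/2)) * (x ^ 2)⁻¹ := by
            gcongr; linarith
        _ = _ := by ring
  have hIic : IntegrableOn (fun x : ℝ => |(Real.log |x|)| * (1 + x ^ 2)⁻¹) (Set.Iic 0) := by
    have := hIoi.comp_neg
    simp only [abs_neg, neg_sq] at this
    rw [Set.neg_Ioi, neg_zero] at this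
    exact (integrableOn_Iic_iff_integrableOn_Iio (by finiteness)).2 this
  rw [← integrableOn_univ, ← Set.Iic_union_Ioi (a := (0:ℝ))]
  exact hIic.union hIoi

open scoped FourierTransform in
/-- `∫ e^{-π x²/r²} 𝓕 g = ∫ r e^{-π r² ξ²} g` -/
lemma lk_gauss_pair {g : ℝ → ℂ} (hg : Integrable g) {r : ℝ} (hr : 0 < r) :
    ∫ x : ℝ, ((Real.exp (-(Real.pi * x ^ 2 / r ^ 2)) : ℝ) : ℂ) * 𝓕 g x =
      ∫ ξ : ℝ, (r : ℂ) * (((Real.exp (-(Real.pi * ξ ^ 2) * r ^ 2) : ℝ) : ℂ) * g ξ) := by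
  have hpi := Real.pi_pos
  have hb : 0 < (((r ^ 2)⁻¹ : ℝ) : ℂ).re := by
    rw [Complex.ofReal_re]; positivity
  have hgi : Integrable (fun x : ℝ => Complex.exp (-Real.pi * (((r ^ 2)⁻¹ : ℝ) : ℂ) * x ^ 2)) := by
    have := integrable_cexp_neg_mul_sq (b := Real.pi * (((r ^ 2)⁻¹ : ℝ) : ℂ)) (by
      rw [Complex.re_ofReal_mul]; exact mul_pos hpi hb)
    simpa only [neg_mul] using this
  have h := VectorFourier.integral_fourierIntegral_smul_eq_flip (L := innerₗ ℝ)
      (μ := volume) (ν := volume)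
      Real.continuous_fourierChar continuous_inner hgi hg
  have h' : ∫ ξ : ℝ, 𝓕 (fun x : ℝ => Complex.exp (-Real.pi * (((r ^ 2)⁻¹ : ℝ) : ℂ) * x ^ 2)) ξ • g ξ
      = ∫ x : ℝ, Complex.exp (-Real.pi * (((r ^ 2)⁻¹ : ℝ) : ℂ) * x ^ 2) • 𝓕 g x := by
    simpa using! h
  rw [fourier_gaussian_pi hb] at h'
  have e1 : (1 : ℂ) / (((r ^ 2)⁻¹ : ℝ) : ℂ) ^ (1 / 2 : ℂ) = r := by
    rw [show (1 / 2 : ℂ) = ((1 / 2 : ℝ) : ℂ) by push_cast; ring,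
      ← Complex.ofReal_cpow (by positivity), ← Real.sqrt_eq_rpow, Real.sqrt_inv,
      Real.sqrt_sq hr.le]
    push_cast
    simp
  rw [e1] at h'
  convert h'.symm using 1
  · congr 1; ext x
    rw [smul_eq_mul]
    congr 1
    push_cast
    congr 1
    ring
  · congr 1; ext x
    rw [smul_eq_mul, mul_assoc]
    congr 2
    push_cast
    congr 1
    rw [div_inv_eq_mul]
    ring

lemma lk_gauss_int {ξ : ℝ} (hξ : ξ ≠ 0) :
    IntegrableOn (fun r : ℝ => Real.exp (-(Real.pi * ξ ^ 2) * r ^ 2)) (Set.Ioi 0) ∧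
    ∫ r in Set.Ioi (0:ℝ), Real.exp (-(Real.pi * ξ ^ 2) * r ^ 2) = 1 / (2 * |ξ|) := by
  have hpi := Real.pi_pos
  have : 0 < Real.pi * ξ ^ 2 := by positivity
  refine ⟨(integrable_exp_neg_mul_sq this).integrableOn, ?_⟩
  rw [integral_gaussian_Ioi, show Real.pi / (Real.pi * ξ ^ 2) = (|ξ|⁻¹) ^ 2 by
    rw [inv_pow, sq_abs]; field_simp, Real.sqrt_sq (by positivity)]
  field_simp

lemma lk_ae_ne : ∀ᵐ x : ℝ, x ≠ 0 := by
  simp [ae_iff]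

open scoped FourierTransform in
lemma lk_main (f : SchwartzMap ℝ ℂ) (G : ℝ → ℂ)
    (hGdef : G = 𝓕 (fun ξ : ℝ => ((|ξ| : ℝ) : ℂ) * f ξ))
    (hGc : Continuous G) (hGi : Integrable G) 
    (hlog : Integrable (fun x : ℝ => ((Real.log |x| : ℝ) : ℂ) * G x)) :
    ∫ x : ℝ, ((Real.log |x| : ℝ) : ℂ) * G x = -(1 / 2) * ∫ ξ : ℝ, f ξ := by
  have hg := lk_g_integrable f
  have hfc := f.continuous
  have hgc : Continuous (fun ξ : ℝ => ((|ξ| : ℝ) : ℂ) * f ξ) := by fun_prop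
  have hG0 : ∫ x, G x = 0 := by
    have h := congrFun (hgc.fourierInv_fourier_eq hg (hGdef ▸ hGi)) 0
    rw [← hGdef, Real.fourierInv_eq] at h
    simpa using h
  -- first Fubini
  have hprod : Integrable (Function.uncurry fun (x r : ℝ) => ((lkK r x : ℝ) : ℂ) * G x)
      (volume.prod (volume.restrict (Set.Ioi 0))) := by
    rw [integrable_prod_iff]
    · refine ⟨?_, ?_⟩
      · filter_upwards [lk_ae_ne] with x hx
        exact (lkK_integrable hx).ofReal.mul_const (G x)
      · refine hlog.norm.congr ?_
        filter_upwards [lk_ae_ne] with x hx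
        simp only [Function.uncurry, norm_mul, Complex.norm_real, Real.norm_eq_abs]
        rw [integral_mul_const, lkK_integral_abs hx]
    · have : Measurable (Function.uncurry fun (x r : ℝ) => ((lkK r x : ℝ) : ℂ) * G x) := by
        unfold lkK Function.uncurry
        have := hGc.measurable
        fun_prop
      exact this.aestronglyMeasurable
  have hswap := integral_integral_swap hprod
  have hL : ∫ x : ℝ, ((Real.log |x| : ℝ) : ℂ) * G x =
      ∫ x : ℝ, ∫ r in Set.Ioi (0:ℝ), ((lkK r x : ℝ) : ℂ) * G x := by
    refine integral_congr_ae ?_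
    filter_upwards [lk_ae_ne] with x hx
    rw [integral_mul_const, integral_complex_ofReal, lkK_integral hx]
  -- second Fubini
  have hprod2 : Integrable (Function.uncurry fun (ξ r : ℝ) =>
      ((Real.exp (-(Real.pi * ξ ^ 2) * r ^ 2) : ℝ) : ℂ) * (((|ξ| : ℝ) : ℂ) * f ξ))
      (volume.prod (volume.restrict (Set.Ioi 0))) := by
    rw [integrable_prod_iff]
    · refine ⟨?_, ?_⟩
      · filter_upwards [lk_ae_ne] with x hx
        exact (lk_gauss_int hx).1.ofReal.mul_const (((|x| : ℝ) : ℂ) * f x)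
      · refine (f.integrable.norm.const_mul (1 / 2)).congr ?_
        filter_upwards [lk_ae_ne] with x hx
        simp only [Function.uncurry, norm_mul, Complex.norm_real, Real.norm_eq_abs, Real.abs_exp,
          abs_abs]
        rw [integral_mul_const, (lk_gauss_int hx).2]
        have := abs_pos.2 hx
        field_simp
    · exact Continuous.aestronglyMeasurable (by unfold Function.uncurry; fun_prop)
  have hswap2 := integral_integral_swap hprod2
  have hR : ∫ ξ : ℝ, ∫ r in Set.Ioi (0:ℝ),
      ((Real.exp (-(Real.pi * ξ ^ 2) * r ^ 2) : ℝ) : ℂ) * (((|ξ| : ℝ) : ℂ) * f ξ)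
      = (1 / 2) * ∫ ξ, f ξ := by
    rw [← integral_const_mul]
    refine integral_congr_ae ?_
    filter_upwards [lk_ae_ne] with x hx
    rw [integral_mul_const, integral_complex_ofReal, (lk_gauss_int hx).2]
    have : ((|x| : ℝ) : ℂ) ≠ 0 := by exact_mod_cast abs_ne_zero.2 hx
    push_cast
    field_simp
  rw [hL, hswap, neg_mul, ← hR, hswap2, ← integral_neg]
  refine setIntegral_congr_fun measurableSet_Ioi fun r hr => ?_
  have hr' : 0 < r := hr
  have hpi := Real.pi_pos
  have hpair := lk_gauss_pair hg hr'
  rw [← hGdef, integral_const_mul] at hpair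
  have hi2 : Integrable fun x : ℝ => ((Real.exp (-(Real.pi * x ^ 2 / r ^ 2)) : ℝ) : ℂ) * G x := by
    refine hGi.mono (Continuous.aestronglyMeasurable (by fun_prop)) 
      (Filter.Eventually.of_forall fun x => ?_)
    rw [norm_mul, Complex.norm_real, Real.norm_eq_abs, Real.abs_exp]
    refine mul_le_of_le_one_left (norm_nonneg _) (Real.exp_le_one_iff.2 ?_)
    rw [neg_nonpos]; positivity
  have : ∀ x : ℝ, ((lkK r x : ℝ) : ℂ) * G x =
      (r : ℂ)⁻¹ * ((Real.exp (-(Real.pi / r ^ 2)) : ℝ) : ℂ) * G x -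
      (r : ℂ)⁻¹ * (((Real.exp (-(Real.pi * x ^ 2 / r ^ 2)) : ℝ) : ℂ) * G x) := by
    intro x; unfold lkK; push_cast; ring
  simp_rw [this]
  rw [integral_sub (hGi.const_mul _) (hi2.const_mul _), integral_const_mul, integral_const_mul,
    hG0, hpair, mul_zero, zero_sub, ← mul_assoc, inv_mul_cancel₀ (by exact_mod_cast hr'.ne'), one_mul]

/-- **The Fourier transform of the logarithmic kernel.** For a Schwartz function `f`,
`∫ log|x| (∫ e^{-2πixξ} |ξ| f(ξ) dξ) dx = -(1/2) ∫ f`. -/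
theorem log_kernel_fourier (f : SchwartzMap ℝ ℂ) :
    Integrable (fun x : ℝ => ((Real.log |x| : ℝ) : ℂ) *
        ∫ ξ : ℝ, Complex.exp (-(2 * (Real.pi : ℂ) * Complex.I * (x : ℂ) * (ξ : ℂ))) *
          ((|ξ| : ℝ) : ℂ) * f ξ) ∧
    (∫ x : ℝ, ((Real.log |x| : ℝ) : ℂ) *
        ∫ ξ : ℝ, Complex.exp (-(2 * (Real.pi : ℂ) * Complex.I * (x : ℂ) * (ξ : ℂ))) *
          ((|ξ| : ℝ) : ℂ) * f ξ)
      = -(1 / 2) * ∫ ξ : ℝ, f ξ := by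
  obtain ⟨C, hC, hdec⟩ := lk_decay f
  have hg := lk_g_integrable f
  let G : ℝ → ℂ := fun x => ∫ ξ : ℝ, Complex.exp (-(2 * (Real.pi : ℂ) * Complex.I * (x : ℂ) * (ξ : ℂ))) *
          ((|ξ| : ℝ) : ℂ) * f ξ
  have hGdef : G = FourierTransform.fourier (fun ξ : ℝ => ((|ξ| : ℝ) : ℂ) * f ξ) := by
    ext x
    rw [Real.fourier_real_eq_integral_exp_smul]
    refine integral_congr_ae (Filter.Eventually.of_forall fun ξ => ?_)
    simp only [smul_eq_mul, mul_assoc]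
    congr 2
    push_cast; ring
  have hGc : Continuous G := by
    rw [hGdef]
    exact VectorFourier.fourierIntegral_continuous Real.continuous_fourierChar
      (L := innerₗ ℝ) continuous_inner hg
  have hGi : Integrable G := by
    refine Integrable.mono' (integrable_inv_one_add_sq.const_mul C) hGc.aestronglyMeasurable
      (Filter.Eventually.of_forall hdec)
  have hlm : Measurable (fun x : ℝ => Real.log |x|) := by
    simp only [Real.log_abs]
    exact Real.measurable_log
  have hlog : Integrable (fun x : ℝ => ((Real.log |x| : ℝ) : ℂ) * G x) := by
    refine Integrable.mono' (lk_log_integrable.const_mul C) ?_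
      (Filter.Eventually.of_forall fun x => ?_)
    · have := hGc.measurable
      exact (by fun_prop : Measurable _).aestronglyMeasurable
    · rw [norm_mul, Complex.norm_real, Real.norm_eq_abs]
      calc _ ≤ |(Real.log |x|)| * (C * (1 + x ^ 2)⁻¹) :=
            mul_le_mul_of_nonneg_left (hdec x) (abs_nonneg _)
        _ = _ := by ring
  exact ⟨hlog, lk_main f G hGdef hGc hGi hlog⟩
end
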